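/- arXiv:1212.2851 — 4 statements merged into one kernel-verified Lean document; each statement's English description precedes it below -/
import Mathlib

section
/- Let b₅ and b₆ be skew lines in ℙ³(ℂ) and let a₁, a₂, a₃, a₄, c₅₆ be five pairwise skew lines each meeting both b₅ and b₆. Then any two nonsingular cubic surfaces containing all seven lines are projectively equivalent; moreover, the projective transformation can be chosen so that it maps each of the seven lines onto itself. -/
noncomputable section

open MvPolynomial

/-- The standard twistor structure `j : ℂ⁴ → ℂ⁴`,
`j(z₁,z₂,z₃,z₄) = (−z̄₂, z̄₁, −z̄₄, z̄₃)`. -/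
def J : (Fin 4 → ℂ) → (Fin 4 → ℂ) :=
  fun z => ![-(starRingEnd ℂ) (z 1), (starRingEnd ℂ) (z 0),
             -(starRingEnd ℂ) (z 3), (starRingEnd ℂ) (z 2)]

/-- A line in `ℙ³(ℂ)`: a 2-dimensional `ℂ`-subspace of `ℂ⁴`. -/
def IsLine (W : Submodule ℂ (Fin 4 → ℂ)) : Prop := Module.finrank ℂ W = 2

/-- A twistor line: a line whose underlying subspace satisfies `j(W) = W`. -/
def IsTwistorLine (W : Submodule ℂ (Fin 4 → ℂ)) : Prop :=
  IsLine W ∧ J '' (W : Set (Fin 4 → ℂ)) = (W : Set (Fin 4 → ℂ))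

/-- A polynomial vanishes identically on a subspace. -/
def VanishesOn (f : MvPolynomial (Fin 4) ℂ) (W : Submodule ℂ (Fin 4 → ℂ)) : Prop :=
  ∀ z ∈ W, eval z f = 0

/-- The surface `{f = 0}` is nonsingular: no nonzero point of `ℂ⁴` is a common zero of
`f` and all its partial derivatives. -/
def Nonsingular (f : MvPolynomial (Fin 4) ℂ) : Prop :=
  ∀ z : Fin 4 → ℂ, z ≠ 0 → eval z f = 0 → ∃ i, eval z (pderiv i f) ≠ 0

section TrilinearForms

variable {V : Type*} [AddCommGroup V] [Module ℂ V]

/-- A trilinear form is symmetric if it is invariant under permutations of its arguments. -/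
def IsSymmTrilinear (Φ : V →ₗ[ℂ] V →ₗ[ℂ] V →ₗ[ℂ] ℂ) : Prop :=
  (∀ u v w, Φ u v w = Φ v u w) ∧ ∀ u v w, Φ u v w = Φ u w v

/-- The part of `Φ` of bidegree `(2, 1)` in `(P, Q)` vanishes at five points of `ℙ¹ × ℙ¹`, namely
`(0, 0)`, `(∞, ∞)`, `(1, 1)`, `(x, z)`, `(y, w)` in the coordinates given by the two frames. -/
structure VanishesAtFrame (Φ : V →ₗ[ℂ] V →ₗ[ℂ] V →ₗ[ℂ] ℂ) (P₁ P₂ Q₁ Q₂ : V)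
    (x y z w : ℂ) : Prop where
  zero : Φ P₁ P₁ Q₁ = 0
  infty : Φ P₂ P₂ Q₂ = 0
  one : Φ (P₁ + P₂) (P₁ + P₂) (Q₁ + Q₂) = 0
  fst : Φ (P₁ + x • P₂) (P₁ + x • P₂) (Q₁ + z • Q₂) = 0
  snd : Φ (P₁ + y • P₂) (P₁ + y • P₂) (Q₁ + w • Q₂) = 0

theorem IsSymmTrilinear.cube_add {Φ : V →ₗ[ℂ] V →ₗ[ℂ] V →ₗ[ℂ] ℂ} (hΦ : IsSymmTrilinear Φ)
    (u v : V) : Φ (u + v) (u + v) (u + v) =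
      Φ u u u + 3 * Φ u u v + 3 * Φ v v u + Φ v v v := by
  have h₁ := hΦ.1 u v u
  have h₂ := hΦ.2 u u v
  have h₃ := hΦ.1 u v v
  have h₄ := hΦ.2 v u v
  simp only [map_add, LinearMap.add_apply]
  linear_combination -2 * h₂ - h₁ + h₃ + 2 * h₄

/-- A symmetric cubic form vanishing on a subspace has vanishing polarization there. -/
theorem IsSymmTrilinear.polar_eq_zero {Φ : V →ₗ[ℂ] V →ₗ[ℂ] V →ₗ[ℂ] ℂ} (hΦ : IsSymmTrilinear Φ)
    {W : Submodule ℂ V} (hW : ∀ z ∈ W, Φ z z z = 0) {p q : V} (hp : p ∈ W) (hq : q ∈ W) :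
    Φ p p q = 0 := by
  have h₁ := hW _ (W.add_mem hp hq)
  have h₂ := hW _ (W.add_mem hp (W.neg_mem hq))
  rw [hΦ.cube_add] at h₁ h₂
  simp only [map_neg, LinearMap.neg_apply] at h₂
  linear_combination (1 / 6) * (h₁ - h₂) - (1 / 3) * hW _ hq

/-- Expansion of the bidegree `(2, 1)` part of `Φ` in a frame where it vanishes at `(0, 0)` and
`(∞, ∞)`. -/
theorem IsSymmTrilinear.mixed_expand {Φ : V →ₗ[ℂ] V →ₗ[ℂ] V →ₗ[ℂ] ℂ} (hΦ : IsSymmTrilinear Φ)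
    {P₁ P₂ Q₁ Q₂ : V} (h₀ : Φ P₁ P₁ Q₁ = 0) (h₁ : Φ P₂ P₂ Q₂ = 0) (s t s' t' : ℂ) :
    Φ (s • P₁ + t • P₂) (s • P₁ + t • P₂) (s' • Q₁ + t' • Q₂) =
      s ^ 2 * t' * Φ P₁ P₁ Q₂ + s * t * s' * (2 * Φ P₁ P₂ Q₁) + s * t * t' * (2 * Φ P₁ P₂ Q₂)
        + t ^ 2 * s' * Φ P₂ P₂ Q₁ := by
  have h₂ := hΦ.1 P₁ P₂ Q₁
  have h₃ := hΦ.1 P₁ P₂ Q₂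
  simp only [map_add, map_smul, LinearMap.add_apply, LinearMap.smul_apply, smul_eq_mul]
  linear_combination s ^ 2 * s' * h₀ + t ^ 2 * t' * h₁ - s * t * s' * h₂ - s * t * t' * h₃

theorem VanishesAtFrame.equations {Φ : V →ₗ[ℂ] V →ₗ[ℂ] V →ₗ[ℂ] ℂ} {P₁ P₂ Q₁ Q₂ : V}
    {x y z w : ℂ} (h : VanishesAtFrame Φ P₁ P₂ Q₁ Q₂ x y z w) (hΦ : IsSymmTrilinear Φ) :
    Φ P₁ P₁ Q₂ + 2 * Φ P₁ P₂ Q₁ + 2 * Φ P₁ P₂ Q₂ + Φ P₂ P₂ Q₁ = 0 ∧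
    z * Φ P₁ P₁ Q₂ + x * (2 * Φ P₁ P₂ Q₁) + x * z * (2 * Φ P₁ P₂ Q₂) + x ^ 2 * Φ P₂ P₂ Q₁ = 0 ∧
    w * Φ P₁ P₁ Q₂ + y * (2 * Φ P₁ P₂ Q₁) + y * w * (2 * Φ P₁ P₂ Q₂) + y ^ 2 * Φ P₂ P₂ Q₁ = 0 := by
  have e := hΦ.mixed_expand h.zero h.infty
  have e₁ := e 1 1 1 1
  have e₂ := e 1 x 1 z
  have e₃ := e 1 y 1 w
  simp only [one_smul, h.one, h.fst, h.snd] at e₁ e₂ e₃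
  exact ⟨by linear_combination -e₁, by linear_combination -e₂, by linear_combination -e₃⟩

/-- If a vector of `ℂ³` is orthogonal to two vectors with nonzero cross product, then it is a
multiple of that cross product. -/
theorem exists_eq_mul_cross {r₁ r₂ r₃ s₁ s₂ s₃ a b c : ℂ}
    (hN : ¬ (r₂ * s₃ - r₃ * s₂ = 0 ∧ r₃ * s₁ - r₁ * s₃ = 0 ∧ r₁ * s₂ - r₂ * s₁ = 0))
    (hr : r₁ * a + r₂ * b + r₃ * c = 0) (hs : s₁ * a + s₂ * b + s₃ * c = 0) :
    ∃ l : ℂ, a = l * (r₂ * s₃ - r₃ * s₂) ∧ b = l * (r₃ * s₁ - r₁ * s₃) ∧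
      c = l * (r₁ * s₂ - r₂ * s₁) := by
  by_cases h₁ : r₂ * s₃ - r₃ * s₂ = 0
  · by_cases h₂ : r₃ * s₁ - r₁ * s₃ = 0
    · have h₃ : r₁ * s₂ - r₂ * s₁ ≠ 0 := fun h => hN ⟨h₁, h₂, h⟩
      refine ⟨c / (r₁ * s₂ - r₂ * s₁), ?_, ?_, ?_⟩ <;> field_simp
      · linear_combination s₂ * hr - r₂ * hs
      · linear_combination -s₁ * hr + r₁ * hs
    · refine ⟨b / (r₃ * s₁ - r₁ * s₃), ?_, ?_, ?_⟩ <;> field_simp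
      · linear_combination -s₃ * hr + r₃ * hs
      · linear_combination s₁ * hr - r₁ * hs
  · refine ⟨a / (r₂ * s₃ - r₃ * s₂), ?_, ?_, ?_⟩ <;> field_simp
    · linear_combination s₃ * hr - r₃ * hs
    · linear_combination -s₂ * hr + r₂ * hs

/-- Unless the five points lie on the graph of a projectivity, the nonzero forms of bidegree
`(2, 1)` through them are proportional. -/
theorem VanishesAtFrame.proportional {Φ Ψ : V →ₗ[ℂ] V →ₗ[ℂ] V →ₗ[ℂ] ℂ} {P₁ P₂ Q₁ Q₂ : V}
    {x y z w : ℂ} (hx₀ : x ≠ 0) (hx₁ : x ≠ 1) (hy₀ : y ≠ 0) (hy₁ : y ≠ 1) (hxy : x ≠ y)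
    (hdeg : ¬ (z = x ∧ w = y)) (hΦs : IsSymmTrilinear Φ) (hΨs : IsSymmTrilinear Ψ)
    (hΦ : VanishesAtFrame Φ P₁ P₂ Q₁ Q₂ x y z w) (hΨ : VanishesAtFrame Ψ P₁ P₂ Q₁ Q₂ x y z w)
    (hΦ₀ : ∃ s t s' t' : ℂ,
      Φ (s • P₁ + t • P₂) (s • P₁ + t • P₂) (s' • Q₁ + t' • Q₂) ≠ 0)
    (hΨ₀ : ∃ s t s' t' : ℂ,
      Ψ (s • P₁ + t • P₂) (s • P₁ + t • P₂) (s' • Q₁ + t' • Q₂) ≠ 0) :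
    ∃ l : ℂ, l ≠ 0 ∧ ∀ s t s' t' : ℂ,
      Ψ (s • P₁ + t • P₂) (s • P₁ + t • P₂) (s' • Q₁ + t' • Q₂) =
        l * Φ (s • P₁ + t • P₂) (s • P₁ + t • P₂) (s' • Q₁ + t' • Q₂) := by
  have hN : ¬ ((x - x ^ 2) * (y * w - y ^ 2) - (x * z - x ^ 2) * (y - y ^ 2) = 0 ∧
      (x * z - x ^ 2) * (w - y ^ 2) - (z - x ^ 2) * (y * w - y ^ 2) = 0 ∧
      (z - x ^ 2) * (y - y ^ 2) - (x - x ^ 2) * (w - y ^ 2) = 0) := by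
    rintro ⟨h₁, -, h₃⟩
    apply hdeg
    have hx₁' : 1 - x ≠ 0 := sub_ne_zero.2 hx₁.symm
    have hy₁' : 1 - y ≠ 0 := sub_ne_zero.2 hy₁.symm
    have e₁ : (1 - x) * (w - y) - (z - x) * (1 - y) = 0 := by
      have : (x * y) * ((1 - x) * (w - y) - (z - x) * (1 - y)) = 0 := by linear_combination h₁
      exact (mul_eq_zero.1 this).resolve_left (mul_ne_zero hx₀ hy₀)
    have e₂ : z - x = 0 := by
      have : ((1 - y) * (y - x)) * (z - x) = 0 := by linear_combination h₃ + x * e₁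
      exact (mul_eq_zero.1 this).resolve_left (mul_ne_zero hy₁' (sub_ne_zero.2 hxy.symm))
    have e₃ : w - y = 0 := by
      have : (1 - x) * (w - y) = 0 := by linear_combination e₁ + (1 - y) * e₂
      exact (mul_eq_zero.1 this).resolve_left hx₁'
    exact ⟨sub_eq_zero.1 e₂, sub_eq_zero.1 e₃⟩
  have key : ∀ Θ : V →ₗ[ℂ] V →ₗ[ℂ] V →ₗ[ℂ] ℂ, IsSymmTrilinear Θ →
      VanishesAtFrame Θ P₁ P₂ Q₁ Q₂ x y z w → ∃ l : ℂ,
      Θ P₁ P₁ Q₂ = l * ((x - x ^ 2) * (y * w - y ^ 2) - (x * z - x ^ 2) * (y - y ^ 2)) ∧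
      2 * Θ P₁ P₂ Q₁ = l * ((x * z - x ^ 2) * (w - y ^ 2) - (z - x ^ 2) * (y * w - y ^ 2)) ∧
      2 * Θ P₁ P₂ Q₂ = l * ((z - x ^ 2) * (y - y ^ 2) - (x - x ^ 2) * (w - y ^ 2)) := by
    intro Θ hs hv
    obtain ⟨h₁, h₂, h₃⟩ := hv.equations hs
    exact exists_eq_mul_cross hN (by linear_combination h₂ - x ^ 2 * h₁)
      (by linear_combination h₃ - y ^ 2 * h₁)
  have expand : ∀ Θ : V →ₗ[ℂ] V →ₗ[ℂ] V →ₗ[ℂ] ℂ, IsSymmTrilinear Θ →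
      VanishesAtFrame Θ P₁ P₂ Q₁ Q₂ x y z w → ∀ s t s' t' : ℂ,
      Θ (s • P₁ + t • P₂) (s • P₁ + t • P₂) (s' • Q₁ + t' • Q₂) =
        (s ^ 2 * t' - t ^ 2 * s') * Θ P₁ P₁ Q₂ + (s * t * s' - t ^ 2 * s') * (2 * Θ P₁ P₂ Q₁) +
          (s * t * t' - t ^ 2 * s') * (2 * Θ P₁ P₂ Q₂) := by
    intro Θ hs hv s t s' t'
    rw [hs.mixed_expand hv.zero hv.infty]
    linear_combination t ^ 2 * s' * (hv.equations hs).1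
  obtain ⟨l, hl₁, hl₂, hl₃⟩ := key Φ hΦs hΦ
  obtain ⟨m, hm₁, hm₂, hm₃⟩ := key Ψ hΨs hΨ
  have hl : l ≠ 0 := by
    rintro rfl
    obtain ⟨s, t, s', t', h⟩ := hΦ₀
    apply h
    rw [expand Φ hΦs hΦ, hl₁, hl₂, hl₃]
    ring
  have hm : m ≠ 0 := by
    rintro rfl
    obtain ⟨s, t, s', t', h⟩ := hΨ₀
    apply h
    rw [expand Ψ hΨs hΨ, hm₁, hm₂, hm₃]
    ring
  refine ⟨m / l, div_ne_zero hm hl, fun s t s' t' => ?_⟩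
  rw [expand Ψ hΨs hΨ, expand Φ hΦs hΦ, hl₁, hl₂, hl₃, hm₁, hm₂, hm₃]
  field_simp

/-- If the five points lie on the graph of a projectivity, the cubic form has a singular point on
the line spanned by `P₁` and `Q₁`. -/
theorem exists_singular_of_graph {Φ : V →ₗ[ℂ] V →ₗ[ℂ] V →ₗ[ℂ] ℂ} (hΦ : IsSymmTrilinear Φ)
    {P₁ P₂ Q₁ Q₂ : V} {x y : ℂ} (hx₀ : x ≠ 0) (hx₁ : x ≠ 1)
    (hP₁ : Φ P₁ P₁ P₁ = 0) (hP₂ : Φ P₁ P₁ P₂ = 0) (hQ₁ : Φ Q₁ Q₁ Q₁ = 0) (hQ₂ : Φ Q₁ Q₁ Q₂ = 0)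
    (hA : VanishesAtFrame Φ P₁ P₂ Q₁ Q₂ x y x y) (hB : VanishesAtFrame Φ Q₁ Q₂ P₁ P₂ x y x y) :
    ∃ h k : ℂ, (h ≠ 0 ∨ k ≠ 0) ∧ ∀ s t s' t' : ℂ,
      Φ (h • P₁ + k • Q₁) (h • P₁ + k • Q₁) ((s • P₁ + t • P₂) + (s' • Q₁ + t' • Q₂)) = 0 := by
  have graph : ∀ {P₁ P₂ Q₁ Q₂ : V}, VanishesAtFrame Φ P₁ P₂ Q₁ Q₂ x y x y →
      Φ P₁ P₁ Q₂ + 2 * Φ P₁ P₂ Q₁ = 0 := by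
    intro P₁ P₂ Q₁ Q₂ hv
    obtain ⟨h₁, h₂, -⟩ := hv.equations hΦ
    have h₃ : x * (1 - x) * (Φ P₁ P₁ Q₂ + 2 * Φ P₁ P₂ Q₁) = 0 := by
      linear_combination h₂ - x ^ 2 * h₁
    exact (mul_eq_zero.1 h₃).resolve_left (mul_ne_zero hx₀ (sub_ne_zero.2 hx₁.symm))
  have hk : ∃ h k : ℂ, (h ≠ 0 ∨ k ≠ 0) ∧ h * Φ P₁ P₁ Q₂ = k * Φ Q₁ Q₁ P₂ := by
    by_cases ha : Φ P₁ P₁ Q₂ = 0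
    · exact ⟨1, 0, by simp, by simp [ha]⟩
    · exact ⟨Φ Q₁ Q₁ P₂, Φ P₁ P₁ Q₂, Or.inr ha, mul_comm _ _⟩
  obtain ⟨h, k, hne, hhk⟩ := hk
  refine ⟨h, k, hne, fun s t s' t' => ?_⟩
  have gA := graph hA
  have gB := graph hB
  have e₁ := hΦ.1 P₁ Q₁ P₁
  have e₂ := hΦ.2 P₁ Q₁ P₁
  have e₃ := hΦ.1 P₁ Q₁ P₂
  have e₄ := hΦ.2 P₁ Q₁ P₂
  have e₅ := hΦ.1 P₁ Q₁ Q₁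
  have e₆ := hΦ.2 Q₁ P₁ Q₁
  have e₇ := hΦ.2 Q₁ P₁ Q₂
  have e₈ := hΦ.1 P₁ Q₁ Q₂
  simp only [map_add, map_smul, LinearMap.add_apply, LinearMap.smul_apply, smul_eq_mul,
    ← e₁, e₂, ← e₃, e₄, e₅, e₆, e₈, e₇, hP₁, hP₂, hQ₁, hQ₂, hA.zero, hB.zero]
  linear_combination (t * h * k) * gA + (t' * h * k) * gB + (h * t' - k * t) * hhk

/-- Five pairwise skew lines meeting a line `b` determine a frame of `b` in which the first three
meeting points are `0`, `∞` and `1`. -/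
theorem exists_frame [FiniteDimensional ℂ V] {b : Submodule ℂ V} (hb : Module.finrank ℂ b = 2)
    (a : Fin 5 → Submodule ℂ V) (ha : ∀ i j, i ≠ j → a i ⊓ a j = ⊥) (hab : ∀ i, a i ⊓ b ≠ ⊥) :
    ∃ P₁ P₂ : V, ∃ x y : ℂ, P₁ ∈ b ∧ P₂ ∈ b ∧ P₁ ≠ 0 ∧ (∀ v ∈ b, ∃ s t : ℂ, v = s • P₁ + t • P₂) ∧
      x ≠ 0 ∧ x ≠ 1 ∧ y ≠ 0 ∧ y ≠ 1 ∧ x ≠ y ∧ P₁ ∈ a 0 ∧ P₂ ∈ a 1 ∧ P₁ + P₂ ∈ a 2 ∧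
      P₁ + x • P₂ ∈ a 3 ∧ P₁ + y • P₂ ∈ a 4 := by
  have hp : ∀ i, ∃ p, p ∈ a i ∧ p ∈ b ∧ p ≠ 0 := by
    intro i
    obtain ⟨p, hp, hp₀⟩ := (Submodule.ne_bot_iff _).1 (hab i)
    exact ⟨p, hp.1, hp.2, hp₀⟩
  choose p hpa hpb hp₀ using hp
  have disj : ∀ {i j v}, i ≠ j → v ∈ a i → v ∈ a j → v = 0 := by
    intro i j v hij hi hj
    have : v ∈ a i ⊓ a j := ⟨hi, hj⟩
    simpa [ha i j hij] using this
  have hli : LinearIndependent ℂ ![p 0, p 1] := by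
    rw [LinearIndependent.pair_iff]
    intro s t hst
    have h₁ : s • p 0 = 0 := by
      refine disj (i := 0) (j := 1) (by decide) ((a 0).smul_mem _ (hpa 0)) ?_
      rw [eq_neg_of_add_eq_zero_left hst]
      exact (a 1).neg_mem ((a 1).smul_mem _ (hpa 1))
    rw [h₁, zero_add] at hst
    exact ⟨(smul_eq_zero.1 h₁).resolve_right (hp₀ 0), (smul_eq_zero.1 hst).resolve_right (hp₀ 1)⟩
  have hspan : Submodule.span ℂ {p 0, p 1} = b := by
    apply Submodule.eq_of_le_of_finrank_eq
    · rw [Submodule.span_le]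
      rintro v (rfl | rfl)
      exacts [hpb 0, hpb 1]
    · have := finrank_span_eq_card hli
      rw [Matrix.range_cons_cons_empty] at this
      rw [hb, this, Fintype.card_fin]
  have hcomb : ∀ v ∈ b, ∃ s t : ℂ, s • p 0 + t • p 1 = v := by
    intro v hv
    rwa [← hspan, Submodule.mem_span_pair] at hv
  have hne : ∀ i, i ≠ 0 → i ≠ 1 → ∃ s t : ℂ, s ≠ 0 ∧ t ≠ 0 ∧ s • p 0 + t • p 1 = p i := by
    intro i hi₀ hi₁
    obtain ⟨s, t, hst⟩ := hcomb _ (hpb i)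
    refine ⟨s, t, ?_, ?_, hst⟩
    · rintro rfl
      apply hp₀ i
      refine disj hi₁ (hpa i) ?_
      rw [← hst, zero_smul, zero_add]
      exact (a 1).smul_mem _ (hpa 1)
    · rintro rfl
      apply hp₀ i
      refine disj hi₀ (hpa i) ?_
      rw [← hst, zero_smul, add_zero]
      exact (a 0).smul_mem _ (hpa 0)
  obtain ⟨α, β, hα, hβ, h₂⟩ := hne 2 (by decide) (by decide)
  have hP₁ : α • p 0 ≠ 0 := smul_ne_zero hα (hp₀ 0)
  have hpar : ∀ i, i ≠ 0 → i ≠ 1 → ∃ x : ℂ, x ≠ 0 ∧ α • p 0 + x • β • p 1 ∈ a i := by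
    intro i hi₀ hi₁
    obtain ⟨s, t, hs, ht, hst⟩ := hne i hi₀ hi₁
    refine ⟨α * t / (s * β), by positivity, ?_⟩
    have : α • p 0 + (α * t / (s * β)) • β • p 1 = (α / s) • p i := by
      rw [← hst, smul_add, smul_smul, smul_smul, smul_smul]
      congr 2 <;> field_simp
    rw [this]
    exact (a i).smul_mem _ (hpa i)
  obtain ⟨x, hx₀, hx⟩ := hpar 3 (by decide) (by decide)
  obtain ⟨y, hy₀, hy⟩ := hpar 4 (by decide) (by decide)
  have h₂' : α • p 0 + β • p 1 ∈ a 2 := h₂ ▸ hpa 2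
  have hadd : ∀ x : ℂ, α • p 0 + x • β • p 1 ≠ 0 := by
    intro x hx
    rw [smul_smul] at hx
    exact hα (LinearIndependent.pair_iff.1 hli _ _ hx).1
  refine ⟨α • p 0, β • p 1, x, y, b.smul_mem _ (hpb 0), b.smul_mem _ (hpb 1), hP₁, ?_, hx₀, ?_, hy₀,
    ?_, ?_, (a 0).smul_mem _ (hpa 0), (a 1).smul_mem _ (hpa 1), h₂', hx, hy⟩
  · intro v hv
    obtain ⟨s, t, rfl⟩ := hcomb v hv
    refine ⟨s / α, t / β, ?_⟩
    rw [smul_smul, smul_smul, div_mul_cancel₀ _ hα, div_mul_cancel₀ _ hβ]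
  · rintro rfl
    rw [one_smul] at hx
    exact hadd 1 (by rw [one_smul]; exact disj (i := 2) (j := 3) (by decide) h₂' hx)
  · rintro rfl
    rw [one_smul] at hy
    exact hadd 1 (by rw [one_smul]; exact disj (i := 2) (j := 4) (by decide) h₂' hy)
  · rintro rfl
    exact hadd x (disj (i := 3) (j := 4) (by decide) hx hy)

/-- A line meeting two skew lines is spanned by the two meeting points. -/
theorem exists_add_of_meet [FiniteDimensional ℂ V] {b c a : Submodule ℂ V} (hbc : b ⊓ c = ⊥)
    (ha : Module.finrank ℂ a = 2) (hb : a ⊓ b ≠ ⊥) (hc : a ⊓ c ≠ ⊥) {v : V} (hv : v ∈ a) :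
    ∃ p ∈ a ⊓ b, ∃ q ∈ a ⊓ c, p + q = v := by
  have hle : (a ⊓ b) ⊔ (a ⊓ c) ≤ a := sup_le inf_le_left inf_le_left
  have hinf : (a ⊓ b) ⊓ (a ⊓ c) = ⊥ :=
    le_bot_iff.1 (hbc ▸ inf_le_inf inf_le_right inf_le_right)
  have hdim := Submodule.finrank_sup_add_finrank_inf_eq (a ⊓ b) (a ⊓ c)
  rw [hinf, finrank_bot] at hdim
  have h₁ := Submodule.one_le_finrank_iff.2 hb
  have h₂ := Submodule.one_le_finrank_iff.2 hc
  have heq : (a ⊓ b) ⊔ (a ⊓ c) = a := Submodule.eq_of_le_of_finrank_le hle (by omega)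
  rw [← heq] at hv
  exact Submodule.mem_sup.1 hv

/-- Scaling two complementary subspaces by nonzero factors is a linear automorphism. -/
theorem exists_scaling {b c : Submodule ℂ V} (h : IsCompl b c) {s t : ℂ} (hs : s ≠ 0)
    (ht : t ≠ 0) : ∃ T : V ≃ₗ[ℂ] V, (∀ u ∈ b, T u = s • u) ∧ ∀ v ∈ c, T v = t • v := by
  let e := Submodule.prodEquivOfIsCompl b c h
  refine ⟨e.symm ≪≫ₗ (LinearEquiv.prodCongr (LinearEquiv.smulOfNeZero ℂ b s hs)
    (LinearEquiv.smulOfNeZero ℂ c t ht)) ≪≫ₗ e, fun u hu => ?_, fun v hv => ?_⟩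
  · have : e.symm u = (⟨u, hu⟩, 0) := by
      rw [LinearEquiv.symm_apply_eq]
      simp [e]
    simp [this, e]
  · have : e.symm v = (0, ⟨v, hv⟩) := by
      rw [LinearEquiv.symm_apply_eq]
      simp [e]
    simp [this, e]

theorem map_eq_of_forall_mem [FiniteDimensional ℂ V] (T : V ≃ₗ[ℂ] V) {W : Submodule ℂ V}
    (h : ∀ v ∈ W, T v ∈ W) : Submodule.map (T : V →ₗ[ℂ] V) W = W := by
  apply Submodule.eq_of_le_of_finrank_eq
  · rintro _ ⟨v, hv, rfl⟩
    exact h v hv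
  · exact LinearEquiv.finrank_map_eq T W

end TrilinearForms

/-- A homogeneous cubic is the cube of a symmetric trilinear form, its polarization, which also
computes its partial derivatives. -/
theorem exists_polarization {f : MvPolynomial (Fin 4) ℂ} (hf : f.IsHomogeneous 3) :
    ∃ Φ : (Fin 4 → ℂ) →ₗ[ℂ] (Fin 4 → ℂ) →ₗ[ℂ] (Fin 4 → ℂ) →ₗ[ℂ] ℂ, IsSymmTrilinear Φ ∧
      (∀ z, eval z f = Φ z z z) ∧ ∀ z i, eval z (pderiv i f) = 3 * Φ z z (Pi.single i 1) := by
  have euler : ∀ {g : MvPolynomial (Fin 4) ℂ} {n : ℕ}, g.IsHomogeneous n → ∀ z : Fin 4 → ℂ,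
      ∑ i, z i * eval z (pderiv i g) = n * eval z g := by
    intro g n hg z
    have := congrArg (eval z) hg.sum_X_mul_pderiv
    simpa [map_sum] using this
  have h₁ : ∀ i, (pderiv i f).IsHomogeneous 2 := fun i => hf.pderiv
  have h₂ : ∀ i j, (pderiv j (pderiv i f)).IsHomogeneous 1 := fun i j => (h₁ i).pderiv
  have h₃ : ∀ i j k, (pderiv k (pderiv j (pderiv i f))).IsHomogeneous 0 :=
    fun i j k => (h₂ i j).pderiv
  have comm : ∀ (g : MvPolynomial (Fin 4) ℂ) i j, pderiv i (pderiv j g) = pderiv j (pderiv i g) := by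
    intro g i j
    have h : ⁅pderiv (R := ℂ) i, pderiv (R := ℂ) j⁆ = 0 := by
      refine MvPolynomial.derivation_ext fun k => ?_
      simp [Derivation.commutator_apply, pderiv_X, Pi.single_apply, apply_ite]
    have := congrArg (fun D => D g) h
    simpa [Derivation.commutator_apply, sub_eq_zero] using this
  let c : Fin 4 → Fin 4 → Fin 4 → ℂ := fun i j k => eval 0 (pderiv k (pderiv j (pderiv i f)))
  have hc : ∀ z i j k, eval z (pderiv k (pderiv j (pderiv i f))) = c i j k := by
    intro z i j k
    have := totalDegree_eq_zero_iff_eq_C.1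
      ((h₃ i j k).totalDegree_le.antisymm (Nat.zero_le _))
    simp only [c]
    rw [this]
    simp
  have c₁ : ∀ i j k, c i j k = c j i k := fun i j k => by simp only [c]; rw [comm f j i]
  have c₂ : ∀ i j k, c i j k = c i k j := fun i j k => by simp only [c]; rw [comm _ k j]
  let π : Fin 4 → (Fin 4 → ℂ) →ₗ[ℂ] ℂ := fun i => LinearMap.proj i
  let Φ : (Fin 4 → ℂ) →ₗ[ℂ] (Fin 4 → ℂ) →ₗ[ℂ] (Fin 4 → ℂ) →ₗ[ℂ] ℂ :=
    ∑ i, ∑ j, ∑ k, (c i j k / 6) • (π i).smulRight ((π j).smulRight (π k))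
  have hΦ : ∀ u v w, Φ u v w = ∑ i, ∑ j, ∑ k, c i j k / 6 * (u i * (v j * w k)) := by
    intro u v w
    simp [Φ, π, LinearMap.sum_apply]
  have d₂ : ∀ z i, eval z (pderiv i f) = ∑ j, ∑ k, c i j k / 2 * (z j * z k) := by
    intro z i
    have e := euler (h₁ i) z
    have e' : ∀ j, eval z (pderiv j (pderiv i f)) = ∑ k, z k * c i j k := by
      intro j
      have := euler (h₂ i j) z
      simp only [hc, Nat.cast_one, one_mul] at this
      exact this.symm
    simp only [e'] at e
    push_cast at e
    rw [← mul_right_inj' (two_ne_zero (α := ℂ)), ← e, Finset.mul_sum]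
    refine Finset.sum_congr rfl fun j _ => ?_
    rw [Finset.mul_sum, Finset.mul_sum]
    exact Finset.sum_congr rfl fun k _ => by ring
  refine ⟨Φ, ⟨fun u v w => ?_, fun u v w => ?_⟩, fun z => ?_, fun z i => ?_⟩
  · rw [hΦ, hΦ, Finset.sum_comm]
    refine Finset.sum_congr rfl fun j _ => Finset.sum_congr rfl fun i _ =>
      Finset.sum_congr rfl fun k _ => ?_
    rw [c₁ i j k]
    ring
  · rw [hΦ, hΦ]
    refine Finset.sum_congr rfl fun i _ => ?_
    rw [Finset.sum_comm]
    refine Finset.sum_congr rfl fun k _ => Finset.sum_congr rfl fun j _ => ?_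
    rw [c₂ i j k]
    ring
  · have e := euler hf z
    simp only [d₂] at e
    push_cast at e
    rw [hΦ, ← mul_right_inj' (three_ne_zero (α := ℂ)), ← e]
    simp only [Finset.mul_sum]
    refine Finset.sum_congr rfl fun i _ => Finset.sum_congr rfl fun j _ =>
      Finset.sum_congr rfl fun k _ => ?_
    ring
  · rw [hΦ, d₂]
    simp only [Pi.single_apply, mul_ite, mul_one, mul_zero, Finset.sum_ite_eq', Finset.mem_univ,
      if_true, Finset.mul_sum]
    refine Finset.sum_congr rfl fun j _ => Finset.sum_congr rfl fun k _ => ?_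
    rw [c₂ j k i, c₁ j i k]
    ring

/-- The polarization of a nonsingular cubic `Φ` satisfies `Φ z z ≠ 0` for `z ≠ 0`. -/
theorem Nonsingular.exists_ne_zero {f : MvPolynomial (Fin 4) ℂ} (hf : Nonsingular f)
    {Φ : (Fin 4 → ℂ) →ₗ[ℂ] (Fin 4 → ℂ) →ₗ[ℂ] (Fin 4 → ℂ) →ₗ[ℂ] ℂ}
    (hΦ : ∀ z, eval z f = Φ z z z)
    (hΦ' : ∀ z i, eval z (pderiv i f) = 3 * Φ z z (Pi.single i 1)) {z : Fin 4 → ℂ} (hz : z ≠ 0) :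
    ∃ v, Φ z z v ≠ 0 := by
  by_contra! h
  obtain ⟨i, hi⟩ := hf z hz (by rw [hΦ, h])
  exact hi (by rw [hΦ', h, mul_zero])

/-- A nonsingular cubic containing two complementary lines has nonzero part of bidegree `(2, 1)`. -/
theorem exists_mixed_ne_zero {V : Type*} [AddCommGroup V] [Module ℂ V]
    {Φ : V →ₗ[ℂ] V →ₗ[ℂ] V →ₗ[ℂ] ℂ} (hΦ : IsSymmTrilinear Φ)
    (hns : ∀ z, z ≠ 0 → ∃ v, Φ z z v ≠ 0) {b c : Submodule ℂ V} (hbc : b ⊔ c = ⊤)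
    (hb : ∀ z ∈ b, Φ z z z = 0) {P₁ P₂ Q₁ Q₂ : V} (hP : P₁ ∈ b) (hP₀ : P₁ ≠ 0)
    (hQ : ∀ v ∈ c, ∃ s t : ℂ, v = s • Q₁ + t • Q₂) :
    ∃ s t s' t' : ℂ, Φ (s • P₁ + t • P₂) (s • P₁ + t • P₂) (s' • Q₁ + t' • Q₂) ≠ 0 := by
  obtain ⟨v, hv⟩ := hns P₁ hP₀
  have hv' : v ∈ b ⊔ c := hbc ▸ Submodule.mem_top
  obtain ⟨p, hp, q, hq, rfl⟩ := Submodule.mem_sup.1 hv'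
  obtain ⟨s, t, rfl⟩ := hQ q hq
  refine ⟨1, 0, s, t, ?_⟩
  rw [one_smul, zero_smul, add_zero]
  rwa [map_add, hΦ.polar_eq_zero hb hP hp, zero_add] at hv

theorem vanishesAtFrame_of_lines {V : Type*} [AddCommGroup V] [Module ℂ V]
    {Φ : V →ₗ[ℂ] V →ₗ[ℂ] V →ₗ[ℂ] ℂ} (hΦ : IsSymmTrilinear Φ) {a : Fin 5 → Submodule ℂ V}
    (ha : ∀ i, ∀ z ∈ a i, Φ z z z = 0) {P₁ P₂ Q₁ Q₂ : V} {x y z w : ℂ}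
    (hP₀ : P₁ ∈ a 0) (hP₁ : P₂ ∈ a 1) (hP₂ : P₁ + P₂ ∈ a 2) (hP₃ : P₁ + x • P₂ ∈ a 3)
    (hP₄ : P₁ + y • P₂ ∈ a 4)
    (hQ₀ : Q₁ ∈ a 0) (hQ₁ : Q₂ ∈ a 1) (hQ₂ : Q₁ + Q₂ ∈ a 2) (hQ₃ : Q₁ + z • Q₂ ∈ a 3)
    (hQ₄ : Q₁ + w • Q₂ ∈ a 4) : VanishesAtFrame Φ P₁ P₂ Q₁ Q₂ x y z w :=
  ⟨hΦ.polar_eq_zero (ha 0) hP₀ hQ₀, hΦ.polar_eq_zero (ha 1) hP₁ hQ₁,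
    hΦ.polar_eq_zero (ha 2) hP₂ hQ₂, hΦ.polar_eq_zero (ha 3) hP₃ hQ₃,
    hΦ.polar_eq_zero (ha 4) hP₄ hQ₄⟩

/-- Given skew lines `b₅, b₆` and five pairwise skew lines each meeting both, any two
nonsingular cubic surfaces containing all seven lines are projectively equivalent, by a
projective transformation mapping each of the seven lines onto itself. -/
theorem cubics_through_seven_lines_projectively_equivalent
    (b₅ b₆ : Submodule ℂ (Fin 4 → ℂ)) (hb₅ : IsLine b₅) (hb₆ : IsLine b₆)
    (hbskew : b₅ ⊓ b₆ = ⊥)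
    (a : Fin 5 → Submodule ℂ (Fin 4 → ℂ)) (haL : ∀ i, IsLine (a i))
    (haskew : ∀ i j, i ≠ j → a i ⊓ a j = ⊥)
    (hmeet₅ : ∀ i, a i ⊓ b₅ ≠ ⊥) (hmeet₆ : ∀ i, a i ⊓ b₆ ≠ ⊥)
    (f g : MvPolynomial (Fin 4) ℂ)
    (hf0 : f ≠ 0) (hfhom : f.IsHomogeneous 3) (hfns : Nonsingular f)
    (hg0 : g ≠ 0) (hghom : g.IsHomogeneous 3) (hgns : Nonsingular g)
    (hfb₅ : VanishesOn f b₅) (hfb₆ : VanishesOn f b₆) (hfa : ∀ i, VanishesOn f (a i))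
    (hgb₅ : VanishesOn g b₅) (hgb₆ : VanishesOn g b₆) (hga : ∀ i, VanishesOn g (a i)) :
    ∃ T : (Fin 4 → ℂ) ≃ₗ[ℂ] (Fin 4 → ℂ),
      (∀ z : Fin 4 → ℂ, eval z f = 0 ↔ eval (T z) g = 0) ∧
      Submodule.map (T : (Fin 4 → ℂ) →ₗ[ℂ] (Fin 4 → ℂ)) b₅ = b₅ ∧
      Submodule.map (T : (Fin 4 → ℂ) →ₗ[ℂ] (Fin 4 → ℂ)) b₆ = b₆ ∧
      ∀ i, Submodule.map (T : (Fin 4 → ℂ) →ₗ[ℂ] (Fin 4 → ℂ)) (a i) = a i := by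
  obtain ⟨Φ, hΦ, hΦf, hΦf'⟩ := exists_polarization hfhom
  obtain ⟨Ψ, hΨ, hΨg, hΨg'⟩ := exists_polarization hghom
  have hΦns : ∀ z, z ≠ 0 → ∃ v, Φ z z v ≠ 0 := fun z hz => hfns.exists_ne_zero hΦf hΦf' hz
  have hΨns : ∀ z, z ≠ 0 → ∃ v, Ψ z z v ≠ 0 := fun z hz => hgns.exists_ne_zero hΨg hΨg' hz
  unfold VanishesOn at hfb₅ hfb₆ hfa hgb₅ hgb₆ hga
  unfold IsLine at hb₅ hb₆ haL
  simp only [hΦf] at hfb₅ hfb₆ hfa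
  simp only [hΨg] at hgb₅ hgb₆ hga
  have hsup : b₅ ⊔ b₆ = ⊤ := by
    apply Submodule.eq_top_of_finrank_eq
    have := Submodule.finrank_sup_add_finrank_inf_eq b₅ b₆
    rw [hbskew, finrank_bot, hb₅, hb₆] at this
    rw [Module.finrank_fin_fun]
    omega
  have hcompl : IsCompl b₅ b₆ := ⟨disjoint_iff.2 hbskew, codisjoint_iff.2 hsup⟩
  obtain ⟨P₁, P₂, x, y, hP₁, hP₂, hPne, hPspan, hx₀, hx₁, hy₀, hy₁, hxy, hPa₀, hPa₁, hPa₂, hPa₃,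
    hPa₄⟩ := exists_frame hb₅ a haskew hmeet₅
  obtain ⟨Q₁, Q₂, z, w, hQ₁, hQ₂, hQne, hQspan, hz₀, hz₁, hw₀, hw₁, hzw, hQa₀, hQa₁, hQa₂, hQa₃,
    hQa₄⟩ := exists_frame hb₆ a haskew hmeet₆
  have hΦA := vanishesAtFrame_of_lines hΦ hfa hPa₀ hPa₁ hPa₂ hPa₃ hPa₄ hQa₀ hQa₁ hQa₂ hQa₃ hQa₄
  have hΦB := vanishesAtFrame_of_lines hΦ hfa hQa₀ hQa₁ hQa₂ hQa₃ hQa₄ hPa₀ hPa₁ hPa₂ hPa₃ hPa₄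
  have hΨA := vanishesAtFrame_of_lines hΨ hga hPa₀ hPa₁ hPa₂ hPa₃ hPa₄ hQa₀ hQa₁ hQa₂ hQa₃ hQa₄
  have hΨB := vanishesAtFrame_of_lines hΨ hga hQa₀ hQa₁ hQa₂ hQa₃ hQa₄ hPa₀ hPa₁ hPa₂ hPa₃ hPa₄
  have hdecomp : ∀ v : Fin 4 → ℂ, ∃ p ∈ b₅, ∃ q ∈ b₆, p + q = v := fun v =>
    Submodule.mem_sup.1 (hsup ▸ Submodule.mem_top)
  have hdeg : ¬ (z = x ∧ w = y) := by
    rintro ⟨rfl, rfl⟩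
    obtain ⟨h, k, hhk, hsing⟩ := exists_singular_of_graph hΦ hx₀ hx₁ (hfb₅ _ hP₁)
      (hΦ.polar_eq_zero hfb₅ hP₁ hP₂) (hfb₆ _ hQ₁) (hΦ.polar_eq_zero hfb₆ hQ₁ hQ₂) hΦA hΦB
    have hne : h • P₁ + k • Q₁ ≠ 0 := by
      intro h₀
      have hmem : h • P₁ ∈ b₅ ⊓ b₆ := by
        refine ⟨b₅.smul_mem _ hP₁, ?_⟩
        rw [eq_neg_of_add_eq_zero_left h₀]
        exact b₆.neg_mem (b₆.smul_mem _ hQ₁)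
      rw [hbskew, Submodule.mem_bot] at hmem
      rw [hmem, zero_add] at h₀
      rcases hhk with hh | hk
      · exact smul_ne_zero hh hPne hmem
      · exact smul_ne_zero hk hQne h₀
    obtain ⟨v, hv⟩ := hΦns _ hne
    obtain ⟨p, hp, q, hq, rfl⟩ := hdecomp v
    obtain ⟨s, t, rfl⟩ := hPspan p hp
    obtain ⟨s', t', rfl⟩ := hQspan q hq
    exact hv (hsing s t s' t')
  have hdeg' : ¬ (x = z ∧ y = w) := fun h => hdeg ⟨h.1.symm, h.2.symm⟩
  obtain ⟨l, hl, hlA⟩ := VanishesAtFrame.proportional hx₀ hx₁ hy₀ hy₁ hxy hdeg hΦ hΨ hΦA hΨA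
    (exists_mixed_ne_zero hΦ hΦns hsup hfb₅ hP₁ hPne hQspan)
    (exists_mixed_ne_zero hΨ hΨns hsup hgb₅ hP₁ hPne hQspan)
  obtain ⟨m, hm, hmB⟩ := VanishesAtFrame.proportional hz₀ hz₁ hw₀ hw₁ hzw hdeg' hΦ hΨ hΦB hΨB
    (exists_mixed_ne_zero hΦ hΦns (sup_comm b₅ b₆ ▸ hsup) hfb₆ hQ₁ hQne hPspan)
    (exists_mixed_ne_zero hΨ hΨns (sup_comm b₅ b₆ ▸ hsup) hgb₆ hQ₁ hQne hPspan)
  obtain ⟨T, hT₅, hT₆⟩ := exists_scaling hcompl hm hl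
  refine ⟨T, fun v => ?_, map_eq_of_forall_mem T fun v hv => ?_,
    map_eq_of_forall_mem T fun v hv => ?_, fun i => map_eq_of_forall_mem T fun v hv => ?_⟩
  · obtain ⟨p, hp, q, hq, rfl⟩ := hdecomp v
    have hA : Ψ p p q = l * Φ p p q := by
      obtain ⟨s, t, rfl⟩ := hPspan p hp
      obtain ⟨s', t', rfl⟩ := hQspan q hq
      exact hlA s t s' t'
    have hB : Ψ q q p = m * Φ q q p := by
      obtain ⟨s, t, rfl⟩ := hPspan p hp
      obtain ⟨s', t', rfl⟩ := hQspan q hq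
      exact hmB s' t' s t
    have hfg : Ψ (T (p + q)) (T (p + q)) (T (p + q)) =
        l ^ 2 * m ^ 2 * Φ (p + q) (p + q) (p + q) := by
      rw [map_add T, hT₅ p hp, hT₆ q hq, hΨ.cube_add, hΦ.cube_add]
      simp only [map_smul, LinearMap.smul_apply, smul_eq_mul, hA, hB, hgb₅ p hp, hgb₆ q hq,
        hfb₅ p hp, hfb₆ q hq]
      ring
    rw [hΦf, hΨg, hfg]
    simp [hl, hm]
  · rw [hT₅ v hv]
    exact b₅.smul_mem _ hv
  · rw [hT₆ v hv]
    exact b₆.smul_mem _ hv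
  · obtain ⟨p, hp, q, hq, rfl⟩ := exists_add_of_meet hbskew (haL i) (hmeet₅ i) (hmeet₆ i) hv
    rw [map_add, hT₅ p hp.2, hT₆ q hq.2]
    exact (a i).add_mem ((a i).smul_mem _ hp.1) ((a i).smul_mem _ hq.1)
end
end

section
/- Let t₁, …, t₅ be five distinct complex numbers, and for each i let aᵢ be the twistor line with underlying subspace span{(0, tᵢ, 0, 1), (t̄ᵢ, 0, 1, 0)} (the twistor fibres through five points of the 2-sphere that is the image of the line {z₁ = z₃ = 0}). Then there exists a nonsingular cubic surface in ℙ³(ℂ) containing all five lines a₁, …, a₅ if and only if no four of the five points lie on a circle, i.e. if and only if for all pairwise distinct indices i, j, k, l the cross-ratio (tᵢ − t_k)(t_j − t_l) / ((tᵢ − t_l)(t_j − t_k)) is not a real number. -/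
noncomputable section

open MvPolynomial

/-- The binary quadratic form with coefficients `a`. -/
def binQuad (a : Fin 3 → ℂ) (u v : ℂ) : ℂ := a 0 * u ^ 2 + a 1 * (u * v) + a 2 * v ^ 2

/-- The binary quadratic form with coefficients `a`, in the variables `Xᵢ`, `Xⱼ`. -/
def binQuadPoly (a : Fin 3 → ℂ) (i j : Fin 4) : MvPolynomial (Fin 4) ℂ :=
  C (a 0) * X i ^ 2 + C (a 1) * (X i * X j) + C (a 2) * X j ^ 2

/-- The cubic with parts of bidegree `(2,1)` and `(1,2)` in the pairs of variables `(z₁,z₃)`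
and `(z₂,z₄)`. -/
def bidegreeCubic (A B A' B' : Fin 3 → ℂ) : MvPolynomial (Fin 4) ℂ :=
  X 1 * binQuadPoly A 0 2 + X 3 * binQuadPoly B 0 2 +
    (X 0 * binQuadPoly A' 1 3 + X 2 * binQuadPoly B' 1 3)

/-- No nonzero form of bidegree `(1,1)` vanishes at four of the points `(xᵢ, yᵢ)`. -/
def NoFourOnConic (x y : Fin 5 → ℂ) : Prop :=
  ∀ i j k l : Fin 5, i ≠ j → i ≠ k → i ≠ l → j ≠ k → j ≠ l → k ≠ l → ∀ c : Fin 4 → ℂ,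
    (∀ m, m = i ∨ m = j ∨ m = k ∨ m = l →
      c 0 * (x m * y m) + c 1 * x m + c 2 * y m + c 3 = 0) → c = 0

lemma NoFourOnConic.symm {x y : Fin 5 → ℂ} (h : NoFourOnConic x y) : NoFourOnConic y x := by
  intro i j k l h1 h2 h3 h4 h5 h6 c hc
  have := h i j k l h1 h2 h3 h4 h5 h6 ![c 0, c 2, c 1, c 3] (fun m hm => by
    have := hc m hm
    simp
    linear_combination this)
  funext m
  have h0 := congrFun this 0
  have h1 := congrFun this 1
  have h2 := congrFun this 2
  have h3 := congrFun this 3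
  simp at h0 h1 h2 h3
  fin_cases m <;> simp [*]

lemma NoFourOnConic.eq_zero_of_forall_ne {x y : Fin 5 → ℂ} (h : NoFourOnConic x y) (n : Fin 5)
    (c : Fin 4 → ℂ)
    (hc : ∀ m, m ≠ n → c 0 * (x m * y m) + c 1 * x m + c 2 * y m + c 3 = 0) : c = 0 := by
  have key : ∀ n : Fin 5, n + 1 ≠ n + 2 ∧ n + 1 ≠ n + 3 ∧ n + 1 ≠ n + 4 ∧ n + 2 ≠ n + 3 ∧
      n + 2 ≠ n + 4 ∧ n + 3 ≠ n + 4 ∧ n + 1 ≠ n ∧ n + 2 ≠ n ∧ n + 3 ≠ n ∧ n + 4 ≠ n := by decide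
  obtain ⟨h1, h2, h3, h4, h5, h6, k1, k2, k3, k4⟩ := key n
  refine h _ _ _ _ h1 h2 h3 h4 h5 h6 c ?_
  rintro m (rfl | rfl | rfl | rfl) <;> exact hc _ (by assumption)

lemma exists_binQuad_pair (x y : Fin 5 → ℂ) :
    ∃ A B : Fin 3 → ℂ, (A ≠ 0 ∨ B ≠ 0) ∧
      ∀ i, y i * binQuad A (x i) 1 + binQuad B (x i) 1 = 0 := by
  let L : ((Fin 3 → ℂ) × (Fin 3 → ℂ)) →ₗ[ℂ] (Fin 5 → ℂ) :=
    { toFun := fun p i => y i * binQuad p.1 (x i) 1 + binQuad p.2 (x i) 1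
      map_add' := fun p q => by
        funext i
        simp only [binQuad, Prod.fst_add, Prod.snd_add, Pi.add_apply]
        ring
      map_smul' := fun c p => by
        funext i
        simp only [binQuad, Prod.smul_fst, Prod.smul_snd, Pi.smul_apply, smul_eq_mul,
          RingHom.id_apply]
        ring }
  have hL : LinearMap.ker L ≠ ⊥ := LinearMap.ker_ne_bot_of_finrank_lt (by simp)
  obtain ⟨p, hp, hp0⟩ := (Submodule.ne_bot_iff _).1 hL
  refine ⟨p.1, p.2, ?_, fun i => congrFun (LinearMap.mem_ker.1 hp) i⟩
  by_contra! h
  exact hp0 (Prod.ext h.1 h.2)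

lemma binQuad_no_common_zero {x y : Fin 5 → ℂ} (hx : Function.Injective x)
    (h : NoFourOnConic x y) {A B : Fin 3 → ℂ} (hAB : A ≠ 0 ∨ B ≠ 0)
    (hP : ∀ i, y i * binQuad A (x i) 1 + binQuad B (x i) 1 = 0) {u v : ℂ}
    (hA : binQuad A u v = 0) (hB : binQuad B u v = 0) : u = 0 ∧ v = 0 := by
  suffices hs : (u ≠ 0 ∨ v ≠ 0) → A = 0 ∧ B = 0 by
    by_contra hc
    have := hs (by tauto)
    tauto
  intro huv
  simp only [binQuad] at *
  by_cases hv : v = 0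
  · subst hv
    have hu : u ≠ 0 := by simpa using huv
    have hA0 : A 0 = 0 := by simpa [hu] using hA
    have hB0 : B 0 = 0 := by simpa [hu] using hB
    have := h.eq_zero_of_forall_ne 0 ![A 1, B 1, A 2, B 2] (fun m _ => by
      have := hP m
      simp only [hA0, hB0] at this
      simp
      linear_combination this)
    have h0 := congrFun this 0
    have h1 := congrFun this 1
    have h2 := congrFun this 2
    have h3 := congrFun this 3
    simp at h0 h1 h2 h3
    constructor <;> funext m <;> fin_cases m <;> simp [*]
  · obtain ⟨ξ, rfl⟩ : ∃ ξ, u = ξ * v := ⟨u / v, by field_simp⟩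
    have hA' : A 0 * ξ ^ 2 + A 1 * ξ + A 2 = 0 := by
      have : v ^ 2 ≠ 0 := pow_ne_zero 2 hv
      apply mul_left_cancel₀ this
      linear_combination hA
    have hB' : B 0 * ξ ^ 2 + B 1 * ξ + B 2 = 0 := by
      have : v ^ 2 ≠ 0 := pow_ne_zero 2 hv
      apply mul_left_cancel₀ this
      linear_combination hB
    obtain ⟨n, hn⟩ : ∃ n, ∀ m, m ≠ n → x m ≠ ξ := by
      by_cases hex : ∃ n, x n = ξ
      · obtain ⟨n, rfl⟩ := hex
        exact ⟨n, fun m hm he => hm (hx he)⟩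
      · push Not at hex
        exact ⟨0, fun m _ => hex m⟩
    have := h.eq_zero_of_forall_ne n ![A 0, B 0, A 0 * ξ + A 1, B 0 * ξ + B 1] (fun m hm => by
      apply mul_left_cancel₀ (sub_ne_zero.2 (hn m hm))
      change (x m - ξ) * (A 0 * (x m * y m) + B 0 * x m + (A 0 * ξ + A 1) * y m +
        (B 0 * ξ + B 1)) = (x m - ξ) * 0
      linear_combination hP m - y m * hA' - hB')
    have h0 := congrFun this 0
    have h1 := congrFun this 1
    have h2 := congrFun this 2
    have h3 := congrFun this 3
    simp at h0 h1 h2 h3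
    simp only [h0, h1] at h2 h3 hA' hB'
    simp at h2 h3
    simp [h2, h3] at hA' hB'
    constructor <;> funext m <;> fin_cases m <;> simp [*]

lemma exists_binQuad_zero (a : Fin 3 → ℂ) :
    ∃ u v : ℂ, (u ≠ 0 ∨ v ≠ 0) ∧ binQuad a u v = 0 := by
  by_cases h : a 0 = 0
  · exact ⟨1, 0, by simp, by simp [binQuad, h]⟩
  · obtain ⟨s, hs⟩ := IsAlgClosed.exists_pow_nat_eq (discrim (a 0) (a 1) (a 2)) two_pos
    obtain ⟨u, hu⟩ := exists_quadratic_eq_zero h ⟨s, by rw [← hs]; ring⟩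
    exact ⟨u, 1, by simp, by simp only [binQuad]; linear_combination hu⟩

lemma cubic_coeffs_eq_zero {x : Fin 4 → ℂ} (hx : Function.Injective x) {a b c d : ℂ}
    (h : ∀ i, a * x i ^ 3 + b * x i ^ 2 + c * x i + d = 0) :
    a = 0 ∧ b = 0 ∧ c = 0 ∧ d = 0 := by
  have hp : (⟨a, b, c, d⟩ : Cubic ℂ).toPoly = 0 := by
    refine Polynomial.eq_zero_of_natDegree_lt_card_of_eval_eq_zero _ hx (fun i => ?_) ?_
    · simpa [Cubic.toPoly] using h i
    · rw [Cubic.toPoly, Fintype.card_fin, Nat.lt_succ_iff]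
      compute_degree
  simpa [Cubic.ext_iff, show (0 : Cubic ℂ) = ⟨0, 0, 0, 0⟩ from rfl] using
    (Cubic.toPoly_eq_zero_iff _).1 hp

lemma quintic_eq_C_mul_prod {x : Fin 5 → ℂ} (hx : Function.Injective x) {p : Polynomial ℂ}
    (hp : p.natDegree ≤ 5) (h : ∀ i, p.eval (x i) = 0) :
    p = Polynomial.C (p.coeff 5) * ∏ i, (Polynomial.X - Polynomial.C (x i)) := by
  have hm : (∏ i, (Polynomial.X - Polynomial.C (x i))).Monic :=
    Polynomial.monic_prod_of_monic _ _ fun i _ => Polynomial.monic_X_sub_C _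
  have hd : (∏ i, (Polynomial.X - Polynomial.C (x i))).natDegree = 5 := by
    rw [Polynomial.natDegree_prod_of_monic _ _ fun i _ => Polynomial.monic_X_sub_C _]
    simp
  have hc : (∏ i, (Polynomial.X - Polynomial.C (x i))).coeff 5 = 1 := by
    simpa [hd] using hm.coeff_natDegree
  rw [← sub_eq_zero]
  refine Polynomial.eq_zero_of_natDegree_lt_card_of_eval_eq_zero _ hx (fun i => ?_) ?_
  · rw [Polynomial.eval_sub, h i, Polynomial.eval_mul, Polynomial.eval_prod,
      Finset.prod_eq_zero (Finset.mem_univ i) (by simp)]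
    simp
  · rw [Fintype.card_fin, Nat.lt_succ_iff (n := 4), Polynomial.natDegree_le_iff_coeff_eq_zero]
    intro N hN
    rcases eq_or_lt_of_le (Nat.succ_le_of_lt hN) with rfl | hN'
    · simp [hc]
    · rw [Polynomial.coeff_sub, Polynomial.coeff_C_mul,
        Polynomial.coeff_eq_zero_of_natDegree_lt (hp.trans_lt hN'),
        Polynomial.coeff_eq_zero_of_natDegree_lt (hd.trans_lt hN')]
      simp

/-- The bidegree `(1,2)` form with coefficients `A'`, `B'`, evaluated at the point `(u, v)` and
the zero `(-B(u,v), A(u,v))` of the bidegree `(2,1)` form with coefficients `A`, `B`. -/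
def eliminant (A B A' B' : Fin 3 → ℂ) (u v : ℂ) : ℂ :=
  u * binQuad A' (-binQuad B u v) (binQuad A u v) +
    v * binQuad B' (-binQuad B u v) (binQuad A u v)

/-- The binary quadratic form with coefficients `a`, dehomogenized. -/
def quadPoly (a : Fin 3 → ℂ) : Polynomial ℂ :=
  Polynomial.C (a 0) * Polynomial.X ^ 2 + Polynomial.C (a 1) * Polynomial.X + Polynomial.C (a 2)

/-- The eliminant, dehomogenized. -/
def eliminantPoly (A B A' B' : Fin 3 → ℂ) : Polynomial ℂ :=
  Polynomial.X * (Polynomial.C (A' 0) * quadPoly B ^ 2 -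
      Polynomial.C (A' 1) * (quadPoly B * quadPoly A) + Polynomial.C (A' 2) * quadPoly A ^ 2) +
    (Polynomial.C (B' 0) * quadPoly B ^ 2 -
      Polynomial.C (B' 1) * (quadPoly B * quadPoly A) + Polynomial.C (B' 2) * quadPoly A ^ 2)

lemma eval_quadPoly (a : Fin 3 → ℂ) (ξ : ℂ) : (quadPoly a).eval ξ = binQuad a ξ 1 := by
  simp [quadPoly, binQuad]

lemma eval_eliminantPoly (A B A' B' : Fin 3 → ℂ) (ξ : ℂ) :
    (eliminantPoly A B A' B').eval ξ = eliminant A B A' B' ξ 1 := by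
  simp only [eliminantPoly, eliminant, Polynomial.eval_add, Polynomial.eval_mul,
    Polynomial.eval_sub, Polynomial.eval_pow, Polynomial.eval_X, Polynomial.eval_C, eval_quadPoly]
  rw [binQuad.eq_def A', binQuad.eq_def B']
  ring

lemma natDegree_eliminantPoly_le (A B A' B' : Fin 3 → ℂ) :
    (eliminantPoly A B A' B').natDegree ≤ 5 := by
  unfold eliminantPoly quadPoly
  compute_degree

lemma coeff_eliminantPoly (A B A' B' : Fin 3 → ℂ) :
    (eliminantPoly A B A' B').coeff 5 = eliminant A B A' B' 1 0 := by
  unfold eliminantPoly quadPoly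
  compute_degree
  · simp [eliminant, binQuad]
    ring
  all_goals norm_num

lemma binQuad_mul (a : Fin 3 → ℂ) (c u v : ℂ) :
    binQuad a (c * u) (c * v) = c ^ 2 * binQuad a u v := by
  simp only [binQuad]; ring

lemma eliminant_mul (A B A' B' : Fin 3 → ℂ) (c u v : ℂ) :
    eliminant A B A' B' (c * u) (c * v) = c ^ 5 * eliminant A B A' B' u v := by
  simp only [eliminant, binQuad_mul, ← mul_neg]; ring

lemma eliminant_eq_zero {A B A' B' : Fin 3 → ℂ} (h : eliminantPoly A B A' B' = 0) (u v : ℂ) :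
    eliminant A B A' B' u v = 0 := by
  by_cases hv : v = 0
  · have := eliminant_mul A B A' B' u 1 0
    rw [← coeff_eliminantPoly, h] at this
    simpa [hv] using this
  · have := eliminant_mul A B A' B' v (u / v) 1
    rw [← eval_eliminantPoly, h] at this
    simpa [mul_div_cancel₀, hv] using this

lemma exists_eq_mul_of_mul_add_mul_eq_zero {a b p q : ℂ} (hab : a ≠ 0 ∨ b ≠ 0)
    (h : p * a + q * b = 0) : ∃ ρ, p = ρ * -b ∧ q = ρ * a := by
  by_cases ha : a = 0
  · have hb : b ≠ 0 := by tauto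
    refine ⟨-p / b, by field_simp, ?_⟩
    have : q = 0 := by simpa [ha, hb] using h
    simp [ha, this]
  · refine ⟨q / a, ?_, by field_simp⟩
    field_simp
    linear_combination h

/-- A pair of forms of bidegrees `(2,1)` and `(1,2)` through five points in general position. -/
structure FivePointPair (x y : Fin 5 → ℂ) (A B A' B' : Fin 3 → ℂ) : Prop where
  injective_x : Function.Injective x
  injective_y : Function.Injective y
  noFour : NoFourOnConic x y
  ne_zero : A ≠ 0 ∨ B ≠ 0
  ne_zero' : A' ≠ 0 ∨ B' ≠ 0
  eq_zero : ∀ i, y i * binQuad A (x i) 1 + binQuad B (x i) 1 = 0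
  eq_zero' : ∀ i, x i * binQuad A' (y i) 1 + binQuad B' (y i) 1 = 0

namespace FivePointPair

variable {x y : Fin 5 → ℂ} {A B A' B' : Fin 3 → ℂ}

lemma symm (h : FivePointPair x y A B A' B') : FivePointPair y x A' B' A B :=
  ⟨h.injective_y, h.injective_x, h.noFour.symm, h.ne_zero', h.ne_zero, h.eq_zero', h.eq_zero⟩

lemma no_common_zero (h : FivePointPair x y A B A' B') {u v : ℂ}
    (hA : binQuad A u v = 0) (hB : binQuad B u v = 0) : u = 0 ∧ v = 0 :=
  binQuad_no_common_zero h.injective_x h.noFour h.ne_zero h.eq_zero hA hB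

lemma not_proportional (h : FivePointPair x y A B A' B')
    (h01 : A 0 * B 1 = A 1 * B 0) (h02 : A 0 * B 2 = A 2 * B 0) (h12 : A 1 * B 2 = A 2 * B 1) :
    False := by
  have key : ∀ i u v, A i * binQuad B u v = B i * binQuad A u v := by
    intro i u v
    simp only [binQuad]
    fin_cases i <;> simp
    · linear_combination u * v * h01 + v ^ 2 * h02
    · linear_combination -u ^ 2 * h01 + v ^ 2 * h12
    · linear_combination -u ^ 2 * h02 - u * v * h12
  by_cases hA : A = 0
  · obtain ⟨u, v, huv, h0⟩ := exists_binQuad_zero B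
    have := h.no_common_zero (u := u) (v := v) (by simp [hA, binQuad]) h0
    tauto
  · obtain ⟨i, hi⟩ := Function.ne_iff.1 hA
    obtain ⟨u, v, huv, h0⟩ := exists_binQuad_zero A
    have hi' := key i u v
    rw [h0, mul_zero] at hi'
    have := h.no_common_zero h0 ((mul_eq_zero.1 hi').resolve_left hi)
    tauto

lemma eval_eliminantPoly_eq_zero (h : FivePointPair x y A B A' B') (i : Fin 5) :
    (eliminantPoly A B A' B').eval (x i) = 0 := by
  have hB : -binQuad B (x i) 1 = binQuad A (x i) 1 * y i := by
    linear_combination -h.eq_zero i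
  have h1 := binQuad_mul A' (binQuad A (x i) 1) (y i) 1
  have h2 := binQuad_mul B' (binQuad A (x i) 1) (y i) 1
  rw [mul_one] at h1 h2
  rw [eval_eliminantPoly, eliminant, hB, h1, h2]
  linear_combination binQuad A (x i) 1 ^ 2 * h.eq_zero' i

lemma eliminantPoly_ne_zero (h : FivePointPair x y A B A' B') : eliminantPoly A B A' B' ≠ 0 := by
  intro h0
  have hel := eliminant_eq_zero h0
  have hdouble : ∀ i, 2 * (y i * A 0 + B 0) * x i + (y i * A 1 + B 1) = 0 := by
    intro i
    set u := -((y i * A 0 + B 0) * x i + (y i * A 1 + B 1)) with hu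
    set v := y i * A 0 + B 0 with hv
    by_contra hne
    have hPuv : y i * binQuad A u v + 1 * binQuad B u v = 0 := by
      have := h.eq_zero i
      simp only [binQuad] at this ⊢
      rw [hu, hv]
      linear_combination (y i * A 0 + B 0) ^ 2 * this
    have huv : ¬ (u = 0 ∧ v = 0) := by
      rintro ⟨h1, h2⟩
      apply hne
      linear_combination -h1 + x i * h2
    have hAB : binQuad A u v ≠ 0 ∨ binQuad B u v ≠ 0 := by
      by_contra! hc
      exact huv (h.no_common_zero hc.1 hc.2)
    obtain ⟨ρ, h1, h2⟩ := exists_eq_mul_of_mul_add_mul_eq_zero hAB hPuv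
    have hQ : u * binQuad A' (y i) 1 + v * binQuad B' (y i) 1 = 0 := by
      rw [h1, h2, binQuad_mul, binQuad_mul]
      have := hel u v
      rw [eliminant] at this
      linear_combination ρ ^ 2 * this
    have hQ' := h.eq_zero' i
    have hne' : u - x i * v ≠ 0 := by
      intro hc
      apply hne
      rw [hu] at hc
      linear_combination -hc
    have hA' : binQuad A' (y i) 1 = 0 := by
      apply mul_left_cancel₀ hne'
      linear_combination hQ - v * hQ'
    have hB' : binQuad B' (y i) 1 = 0 := by linear_combination hQ' - x i * hA'
    simpa using h.symm.no_common_zero hA' hB'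
  have hw : ∀ i, 0 * x i ^ 3 + (A 0 * B 1 - A 1 * B 0) * x i ^ 2 +
      2 * (A 0 * B 2 - A 2 * B 0) * x i + (A 1 * B 2 - A 2 * B 1) = 0 := by
    intro i
    have h1 := hdouble i
    have h2 := h.eq_zero i
    simp only [binQuad] at h2
    linear_combination (2 * A 0 * x i + A 1) * h2 - (A 0 * x i ^ 2 + A 1 * x i + A 2) * h1
  obtain ⟨-, h1, h2, h3⟩ := cubic_coeffs_eq_zero
    (h.injective_x.comp (Fin.castSucc_injective 4)) (fun i => hw i.castSucc)
  refine h.not_proportional ?_ ?_ ?_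
  · linear_combination h1
  · linear_combination h2 / 2
  · linear_combination h3

lemma coeff_ne_zero (h : FivePointPair x y A B A' B') : (eliminantPoly A B A' B').coeff 5 ≠ 0 := by
  intro h0
  apply h.eliminantPoly_ne_zero
  rw [quintic_eq_C_mul_prod h.injective_x (natDegree_eliminantPoly_le A B A' B')
    h.eval_eliminantPoly_eq_zero, h0]
  simp

lemma separable (h : FivePointPair x y A B A' B') : (eliminantPoly A B A' B').Separable := by
  rw [quintic_eq_C_mul_prod h.injective_x (natDegree_eliminantPoly_le A B A' B')
    h.eval_eliminantPoly_eq_zero]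
  refine Polynomial.Separable.unit_mul
    (Polynomial.isUnit_C.2 (isUnit_iff_ne_zero.2 h.coeff_ne_zero)) ?_
  exact Polynomial.separable_prod_X_sub_C_iff.2 h.injective_x

end FivePointPair

lemma eval_binQuadPoly (a : Fin 3 → ℂ) (i j : Fin 4) (z : Fin 4 → ℂ) :
    eval z (binQuadPoly a i j) = binQuad a (z i) (z j) := by
  simp [binQuadPoly, binQuad]

lemma eval_bidegreeCubic (A B A' B' : Fin 3 → ℂ) (z : Fin 4 → ℂ) :
    eval z (bidegreeCubic A B A' B') =
      z 1 * binQuad A (z 0) (z 2) + z 3 * binQuad B (z 0) (z 2) +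
        (z 0 * binQuad A' (z 1) (z 3) + z 2 * binQuad B' (z 1) (z 3)) := by
  simp [bidegreeCubic, eval_binQuadPoly]

lemma isHomogeneous_bidegreeCubic (A B A' B' : Fin 3 → ℂ) :
    (bidegreeCubic A B A' B').IsHomogeneous 3 := by
  have hq : ∀ (a : Fin 3 → ℂ) (i j : Fin 4), (binQuadPoly a i j).IsHomogeneous 2 := by
    intro a i j
    refine IsHomogeneous.add (IsHomogeneous.add ?_ ?_) ?_
    · exact (isHomogeneous_C _ _).mul ((isHomogeneous_X ℂ i).pow 2)
    · exact (isHomogeneous_C _ _).mul ((isHomogeneous_X ℂ i).mul (isHomogeneous_X ℂ j))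
    · exact (isHomogeneous_C _ _).mul ((isHomogeneous_X ℂ j).pow 2)
  have hl : ∀ (a : Fin 3 → ℂ) (i j k : Fin 4), (X k * binQuadPoly a i j).IsHomogeneous 3 :=
    fun a i j k => (isHomogeneous_X ℂ k).mul (hq a i j)
  exact ((hl _ _ _ _).add (hl _ _ _ _)).add ((hl _ _ _ _).add (hl _ _ _ _))

section
variable (A B A' B' : Fin 3 → ℂ) (z : Fin 4 → ℂ)

lemma eval_pderiv_zero_bidegreeCubic : eval z (pderiv 0 (bidegreeCubic A B A' B')) =
    z 1 * (2 * A 0 * z 0 + A 1 * z 2) + z 3 * (2 * B 0 * z 0 + B 1 * z 2) +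
      binQuad A' (z 1) (z 3) := by
  simp [bidegreeCubic, binQuadPoly, pderiv_X, binQuad]
  ring

lemma eval_pderiv_one_bidegreeCubic : eval z (pderiv 1 (bidegreeCubic A B A' B')) =
    z 0 * (2 * A' 0 * z 1 + A' 1 * z 3) + z 2 * (2 * B' 0 * z 1 + B' 1 * z 3) +
      binQuad A (z 0) (z 2) := by
  simp [bidegreeCubic, binQuadPoly, pderiv_X, binQuad]
  ring

lemma eval_pderiv_two_bidegreeCubic : eval z (pderiv 2 (bidegreeCubic A B A' B')) =
    z 1 * (A 1 * z 0 + 2 * A 2 * z 2) + z 3 * (B 1 * z 0 + 2 * B 2 * z 2) +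
      binQuad B' (z 1) (z 3) := by
  simp [bidegreeCubic, binQuadPoly, pderiv_X, binQuad]
  ring

lemma eval_pderiv_three_bidegreeCubic : eval z (pderiv 3 (bidegreeCubic A B A' B')) =
    z 0 * (A' 1 * z 1 + 2 * A' 2 * z 3) + z 2 * (B' 1 * z 1 + 2 * B' 2 * z 3) +
      binQuad B (z 0) (z 2) := by
  simp [bidegreeCubic, binQuadPoly, pderiv_X, binQuad]
  ring

end

lemma eval_derivative_quadPoly (a : Fin 3 → ℂ) (ξ : ℂ) :
    (quadPoly a).derivative.eval ξ = 2 * a 0 * ξ + a 1 := by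
  simp [quadPoly]; ring

lemma eval_derivative_eliminantPoly (A B A' B' : Fin 3 → ℂ) (ξ : ℂ) :
    (eliminantPoly A B A' B').derivative.eval ξ =
      binQuad A' (-binQuad B ξ 1) (binQuad A ξ 1) +
      (ξ * (2 * A' 0 * -binQuad B ξ 1 + A' 1 * binQuad A ξ 1) +
        (2 * B' 0 * -binQuad B ξ 1 + B' 1 * binQuad A ξ 1)) * -(2 * B 0 * ξ + B 1) +
      (ξ * (A' 1 * -binQuad B ξ 1 + 2 * A' 2 * binQuad A ξ 1) +
        (B' 1 * -binQuad B ξ 1 + 2 * B' 2 * binQuad A ξ 1)) * (2 * A 0 * ξ + A 1) := by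
  rw [binQuad.eq_def A' (-binQuad B ξ 1)]
  simp [eliminantPoly, eval_quadPoly, eval_derivative_quadPoly, Polynomial.derivative_pow]
  ring

lemma FivePointPair.nonsingular {x y : Fin 5 → ℂ} {A B A' B' : Fin 3 → ℂ}
    (h : FivePointPair x y A B A' B') : Nonsingular (bidegreeCubic A B A' B') := by
  intro z hz _
  by_contra! hsing
  have g0 := hsing 0
  have g1 := hsing 1
  have g2 := hsing 2
  have g3 := hsing 3
  rw [eval_pderiv_zero_bidegreeCubic] at g0
  rw [eval_pderiv_one_bidegreeCubic] at g1
  rw [eval_pderiv_two_bidegreeCubic] at g2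
  rw [eval_pderiv_three_bidegreeCubic] at g3
  have hzne : ¬ (z 0 = 0 ∧ z 1 = 0 ∧ z 2 = 0 ∧ z 3 = 0) := by
    rintro ⟨h0, h1, h2, h3⟩
    apply hz
    funext m
    fin_cases m <;> assumption
  by_cases hx0 : z 0 = 0 ∧ z 2 = 0
  · have := h.symm.no_common_zero (u := z 1) (v := z 3) (by simpa [hx0.1, hx0.2] using g0)
      (by simpa [hx0.1, hx0.2] using g2)
    tauto
  by_cases hy0 : z 1 = 0 ∧ z 3 = 0
  · have := h.no_common_zero (u := z 0) (v := z 2) (by simpa [hy0.1, hy0.2] using g1)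
      (by simpa [hy0.1, hy0.2] using g3)
    tauto
  have hP : z 1 * binQuad A (z 0) (z 2) + z 3 * binQuad B (z 0) (z 2) = 0 := by
    simp only [binQuad] at g0 g1 g2 g3 ⊢
    linear_combination (2 * (z 0 * g0 + z 2 * g2) - (z 1 * g1 + z 3 * g3)) / 3
  have hQ : z 0 * binQuad A' (z 1) (z 3) + z 2 * binQuad B' (z 1) (z 3) = 0 := by
    simp only [binQuad] at g0 g1 g2 g3 ⊢
    linear_combination (2 * (z 1 * g1 + z 3 * g3) - (z 0 * g0 + z 2 * g2)) / 3
  have hAB : binQuad A (z 0) (z 2) ≠ 0 ∨ binQuad B (z 0) (z 2) ≠ 0 := by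
    by_contra! hc
    exact hx0 (h.no_common_zero hc.1 hc.2)
  obtain ⟨ρ, h1, h3⟩ := exists_eq_mul_of_mul_add_mul_eq_zero hAB hP
  have hρ : ρ ≠ 0 := by
    rintro rfl
    simp [h1, h3] at hy0
  have hel : eliminant A B A' B' (z 0) (z 2) = 0 := by
    rw [h1, h3, binQuad_mul, binQuad_mul] at hQ
    apply mul_left_cancel₀ (pow_ne_zero 2 hρ)
    rw [eliminant]
    linear_combination hQ
  by_cases h2 : z 2 = 0
  · have h0 : z 0 ≠ 0 := fun h0 => hx0 ⟨h0, h2⟩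
    have := eliminant_mul A B A' B' (z 0) 1 0
    rw [mul_one, mul_zero, ← h2, hel, h2, ← coeff_eliminantPoly] at this
    exact mul_ne_zero (pow_ne_zero 5 h0) h.coeff_ne_zero this.symm
  · obtain ⟨ξ, hξ⟩ : ∃ ξ, z 0 = z 2 * ξ := ⟨z 0 / z 2, by field_simp⟩
    have hsc := eliminant_mul A B A' B' (z 2) ξ 1
    rw [mul_one, ← hξ, hel, ← eval_eliminantPoly] at hsc
    have hroot : (eliminantPoly A B A' B').eval ξ = 0 := by
      simpa [h2] using hsc.symm
    have hA := binQuad_mul A (z 2) ξ 1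
    have hB := binQuad_mul B (z 2) ξ 1
    rw [mul_one, ← hξ] at hA hB
    rw [hB] at h1
    rw [hA] at h3
    refine h.separable.aeval_derivative_ne_zero (x := ξ) (by simpa using hroot) ?_
    rw [Polynomial.coe_aeval_eq_eval, eval_derivative_eliminantPoly]
    rw [hA] at g1
    rw [hB] at g3
    set α := binQuad A ξ 1
    set β := binQuad B ξ 1
    have h1' : z 1 = ρ * z 2 ^ 2 * -β := by rw [h1]; ring
    have h3' : z 3 = ρ * z 2 ^ 2 * α := by rw [h3]; ring
    rw [h1', h3', hξ] at g1 g3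
    rw [h1', h3', binQuad_mul, hξ] at g0
    have hz2 : ρ ^ 2 * z 2 ^ 4 ≠ 0 := by positivity
    apply mul_left_cancel₀ hz2
    linear_combination g0 + ρ * z 2 * ((2 * A 0 * ξ + A 1) * g3 - (2 * B 0 * ξ + B 1) * g1)

/-- The binary cubic form with coefficients `a`, in the variables `Xᵢ`, `Xⱼ`. -/
def binCubicPoly (a : Fin 4 → ℂ) (i j : Fin 4) : MvPolynomial (Fin 4) ℂ :=
  C (a 0) * X i ^ 3 + C (a 1) * (X i ^ 2 * X j) + C (a 2) * (X i * X j ^ 2) + C (a 3) * X j ^ 3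

lemma MvPolynomial.IsHomogeneous.exists_trilinear {f : MvPolynomial (Fin 4) ℂ}
    (hf : f.IsHomogeneous 3) :
    ∃ T : Fin 4 → Fin 4 → Fin 4 → ℂ, f = ∑ i, ∑ j, ∑ k, C (T i j k) * (X i * X j * X k) := by
  have h0 : ∀ g : MvPolynomial (Fin 4) ℂ, g.IsHomogeneous 0 → ∃ c, g = C c := fun g hg =>
    ⟨_, totalDegree_eq_zero_iff_eq_C.1 (Nat.eq_zero_of_le_zero hg.totalDegree_le)⟩
  have h3 : ∀ i j k, ∃ c, pderiv k (pderiv j (pderiv i f)) = C c := fun i j k =>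
    h0 _ ((hf.pderiv (i := i)).pderiv (i := j)).pderiv
  choose T hT using h3
  refine ⟨fun i j k => T i j k / 6, ?_⟩
  have e1 := hf.sum_X_mul_pderiv
  have e2 := fun i => (hf.pderiv (i := i)).sum_X_mul_pderiv
  have e3 := fun i j => ((hf.pderiv (i := i)).pderiv (i := j)).sum_X_mul_pderiv
  simp only [hT] at e3
  have key : (C 6 : MvPolynomial (Fin 4) ℂ) * f =
      ∑ i, ∑ j, ∑ k, C (T i j k) * (X i * X j * X k) := by
    have h6 : (C 6 : MvPolynomial (Fin 4) ℂ) * f = 2 * (3 • f) := by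
      rw [show (C 6 : MvPolynomial (Fin 4) ℂ) = 6 from rfl, nsmul_eq_mul]
      push_cast
      ring
    rw [h6, ← e1, Finset.mul_sum]
    refine Finset.sum_congr rfl fun i _ => ?_
    have := e2 i
    norm_num at this
    rw [mul_left_comm, ← this, Finset.mul_sum]
    refine Finset.sum_congr rfl fun j _ => ?_
    have := e3 i j
    norm_num at this
    rw [← this, Finset.mul_sum, Finset.mul_sum]
    refine Finset.sum_congr rfl fun k _ => ?_
    ring
  have h16 : f = C (1 / 6) * (C 6 * f) := by
    rw [← mul_assoc, ← map_mul]
    norm_num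
  rw [h16, key]
  simp only [Finset.mul_sum]
  refine Finset.sum_congr rfl fun i _ => Finset.sum_congr rfl fun j _ =>
    Finset.sum_congr rfl fun k _ => ?_
  rw [← mul_assoc, ← map_mul, one_div_mul_eq_div]

lemma MvPolynomial.IsHomogeneous.exists_bidegree_decomposition {f : MvPolynomial (Fin 4) ℂ}
    (hf : f.IsHomogeneous 3) :
    ∃ (a b : Fin 4 → ℂ) (A B A' B' : Fin 3 → ℂ),
      f = binCubicPoly a 0 2 + bidegreeCubic A B A' B' + binCubicPoly b 1 3 := by
  obtain ⟨T, rfl⟩ := hf.exists_trilinear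
  let S : Fin 4 → Fin 4 → Fin 4 → ℂ := fun i j k =>
    T i j k + T j k i + T k i j + T i k j + T j i k + T k j i
  refine ⟨![S 0 0 0 / 6, S 0 0 2 / 2, S 0 2 2 / 2, S 2 2 2 / 6],
    ![S 1 1 1 / 6, S 1 1 3 / 2, S 1 3 3 / 2, S 3 3 3 / 6],
    ![S 0 0 1 / 2, S 0 2 1, S 2 2 1 / 2], ![S 0 0 3 / 2, S 0 2 3, S 2 2 3 / 2],
    ![S 1 1 0 / 2, S 1 3 0, S 3 3 0 / 2], ![S 1 1 2 / 2, S 1 3 2, S 3 3 2 / 2], ?_⟩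
  apply MvPolynomial.funext
  intro z
  simp only [map_add, map_mul, eval_C, eval_X, eval_bidegreeCubic, binCubicPoly, binQuad,
    Fin.sum_univ_four, map_pow, S, Matrix.cons_val]
  ring

lemma conic_nondegenerate {x y : Fin 4 → ℂ} (hx : Function.Injective x)
    (hy : Function.Injective y) {c : Fin 4 → ℂ} (hc : c ≠ 0)
    (h : ∀ i, c 0 * (x i * y i) + c 1 * x i + c 2 * y i + c 3 = 0) :
    c 0 * c 3 - c 1 * c 2 ≠ 0 := by
  intro hD
  by_cases h0 : c 0 = 0
  · have hx01 : x 0 - x 1 ≠ 0 := sub_ne_zero.2 (hx.ne (by decide))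
    have hy01 : y 0 - y 1 ≠ 0 := sub_ne_zero.2 (hy.ne (by decide))
    have e := h 0
    have e' := h 1
    rw [h0] at e e' hD
    have h12 : c 1 = 0 ∨ c 2 = 0 := by
      apply mul_eq_zero.1
      linear_combination -hD
    have h1 : c 1 = 0 := by
      rcases h12 with h1 | h2
      · exact h1
      · apply mul_right_cancel₀ hx01
        rw [h2] at e e'
        linear_combination e - e'
    have h2 : c 2 = 0 := by
      apply mul_right_cancel₀ hy01
      rw [h1] at e e'
      linear_combination e - e'
    have h3 : c 3 = 0 := by
      rw [h1, h2] at e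
      linear_combination e
    apply hc
    funext m
    fin_cases m <;> assumption
  · have key : ∀ i, c 0 * x i = -c 2 ∨ c 0 * y i = -c 1 := by
      intro i
      have : (c 0 * x i + c 2) * (c 0 * y i + c 1) = 0 := by
        linear_combination c 0 * h i - hD
      rcases mul_eq_zero.1 this with h | h
      · left; linear_combination h
      · right; linear_combination h
    have kx : ∀ i j, i ≠ j → c 0 * x i = -c 2 → c 0 * x j = -c 2 → False := fun i j hij h1 h2 =>
      hij (hx (mul_left_cancel₀ h0 (h1.trans h2.symm)))
    have ky : ∀ i j, i ≠ j → c 0 * y i = -c 1 → c 0 * y j = -c 1 → False := fun i j hij h1 h2 =>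
      hij (hy (mul_left_cancel₀ h0 (h1.trans h2.symm)))
    have kx01 := kx 0 1 (by decide)
    have kx02 := kx 0 2 (by decide)
    have kx12 := kx 1 2 (by decide)
    have ky01 := ky 0 1 (by decide)
    have ky02 := ky 0 2 (by decide)
    have ky12 := ky 1 2 (by decide)
    rcases key 0 with a | a <;> rcases key 1 with b | b <;> rcases key 2 with d | d <;> tauto

/-- A form of bidegree `(2,1)` vanishing at four points of a smooth conic is divisible by it. -/
lemma exists_conic_quotient {x y : Fin 4 → ℂ} (hx : Function.Injective x)
    {c : Fin 4 → ℂ} (hD : c 0 * c 3 - c 1 * c 2 ≠ 0)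
    (h : ∀ i, c 0 * (x i * y i) + c 1 * x i + c 2 * y i + c 3 = 0) {A B : Fin 3 → ℂ}
    (hP : ∀ i, y i * binQuad A (x i) 1 + binQuad B (x i) 1 = 0) :
    ∃ l m : ℂ, A = ![l * c 0, l * c 2 + m * c 0, m * c 2] ∧
      B = ![l * c 1, l * c 3 + m * c 1, m * c 3] := by
  obtain ⟨h3, h2, h1, h0⟩ := cubic_coeffs_eq_zero hx
    (a := c 0 * B 0 - c 1 * A 0) (b := c 0 * B 1 + c 2 * B 0 - (c 1 * A 1 + c 3 * A 0))
    (c := c 0 * B 2 + c 2 * B 1 - (c 1 * A 2 + c 3 * A 1)) (d := c 2 * B 2 - c 3 * A 2)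
    (fun i => by
      have e := h i
      have e' := hP i
      simp only [binQuad] at e'
      linear_combination (c 0 * x i + c 2) * e' - (A 0 * x i ^ 2 + A 1 * x i + A 2) * e)
  obtain ⟨l, hl⟩ : ∃ l, l * (c 0 * c 3 - c 1 * c 2) = c 3 * A 0 - c 2 * B 0 :=
    ⟨_, div_mul_cancel₀ _ hD⟩
  obtain ⟨m, hm⟩ : ∃ m, m * (c 0 * c 3 - c 1 * c 2) = c 0 * B 2 - c 1 * A 2 :=
    ⟨_, div_mul_cancel₀ _ hD⟩
  have hA0 : A 0 = l * c 0 :=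
    mul_left_cancel₀ hD (by linear_combination -c 0 * hl + c 2 * h3)
  have hA1 : A 1 = l * c 2 + m * c 0 :=
    mul_left_cancel₀ hD (by linear_combination -c 2 * hl - c 0 * hm + c 2 * h2 - c 0 * h1)
  have hA2 : A 2 = m * c 2 :=
    mul_left_cancel₀ hD (by linear_combination -c 2 * hm - c 0 * h0)
  have hB0 : B 0 = l * c 1 :=
    mul_left_cancel₀ hD (by linear_combination -c 1 * hl + c 3 * h3)
  have hB1 : B 1 = l * c 3 + m * c 1 :=
    mul_left_cancel₀ hD (by linear_combination -c 3 * hl - c 1 * hm + c 3 * h2 - c 1 * h1)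
  have hB2 : B 2 = m * c 3 :=
    mul_left_cancel₀ hD (by linear_combination -c 3 * hm - c 1 * h0)
  refine ⟨l, m, ?_, ?_⟩ <;> funext n <;> fin_cases n <;> assumption

lemma not_nonsingular_mul {p q : MvPolynomial (Fin 4) ℂ} {z : Fin 4 → ℂ} (hz : z ≠ 0)
    (hp : eval z p = 0) (hq : eval z q = 0) : ¬ Nonsingular (p * q) := by
  intro h
  obtain ⟨i, hi⟩ := h z hz (by simp [hp])
  simp [hp, hq] at hi

/-- A cubic containing the lines through four points of a smooth conic is singular. -/
lemma not_nonsingular_of_conic {x y : Fin 4 → ℂ} (hx : Function.Injective x)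
    (hy : Function.Injective y) {c : Fin 4 → ℂ} (hc : c ≠ 0)
    (h : ∀ i, c 0 * (x i * y i) + c 1 * x i + c 2 * y i + c 3 = 0)
    {f : MvPolynomial (Fin 4) ℂ} (hf : f.IsHomogeneous 3)
    (hv : ∀ i, ∀ s r : ℂ, eval ![s * x i, r * y i, s, r] f = 0) : ¬ Nonsingular f := by
  obtain ⟨a, b, A, B, A', B', rfl⟩ := hf.exists_bidegree_decomposition
  have hv' : ∀ i s r,
      s ^ 3 * (a 0 * x i ^ 3 + a 1 * x i ^ 2 + a 2 * x i + a 3) +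
      s ^ 2 * r * (y i * binQuad A (x i) 1 + binQuad B (x i) 1) +
      s * r ^ 2 * (x i * binQuad A' (y i) 1 + binQuad B' (y i) 1) +
      r ^ 3 * (b 0 * y i ^ 3 + b 1 * y i ^ 2 + b 2 * y i + b 3) = 0 := by
    intro i s r
    have := hv i s r
    simp only [map_add, map_mul, map_pow, eval_C, eval_X, eval_bidegreeCubic, binCubicPoly,
      binQuad, Matrix.cons_val] at this
    simp only [binQuad]
    linear_combination this
  obtain ⟨ha0, ha1, ha2, ha3⟩ := cubic_coeffs_eq_zero hx fun i => by simpa using hv' i 1 0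
  obtain ⟨hb0, hb1, hb2, hb3⟩ := cubic_coeffs_eq_zero hy fun i => by simpa using hv' i 0 1
  simp only [ha0, ha1, ha2, ha3, hb0, hb1, hb2, hb3] at hv'
  have hP : ∀ i, y i * binQuad A (x i) 1 + binQuad B (x i) 1 = 0 := fun i => by
    linear_combination (hv' i 1 1 + hv' i (-1) 1) / 2
  have hQ : ∀ i, x i * binQuad A' (y i) 1 + binQuad B' (y i) 1 = 0 := fun i => by
    linear_combination (hv' i 1 1 - hv' i (-1) 1) / 2
  have hD := conic_nondegenerate hx hy hc h
  obtain ⟨l, m, rfl, rfl⟩ := exists_conic_quotient hx hD h hP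
  obtain ⟨l', m', rfl, rfl⟩ := exists_conic_quotient (x := y) (y := x)
    (c := ![c 0, c 2, c 1, c 3]) hy
    (by simpa [mul_comm (c 2)] using hD) (fun i => by
      have := h i
      simp
      linear_combination this) hQ
  have hfac : binCubicPoly a 0 2 + bidegreeCubic ![l * c 0, l * c 2 + m * c 0, m * c 2]
      ![l * c 1, l * c 3 + m * c 1, m * c 3]
      ![l' * ![c 0, c 2, c 1, c 3] 0, l' * ![c 0, c 2, c 1, c 3] 2 + m' * ![c 0, c 2, c 1, c 3] 0,
        m' * ![c 0, c 2, c 1, c 3] 2]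
      ![l' * ![c 0, c 2, c 1, c 3] 1, l' * ![c 0, c 2, c 1, c 3] 3 + m' * ![c 0, c 2, c 1, c 3] 1,
        m' * ![c 0, c 2, c 1, c 3] 3] + binCubicPoly b 1 3 =
      (C (c 0) * (X 0 * X 1) + C (c 1) * (X 0 * X 3) + C (c 2) * (X 2 * X 1) +
        C (c 3) * (X 2 * X 3)) * (C l * X 0 + C m * X 2 + C l' * X 1 + C m' * X 3) := by
    apply MvPolynomial.funext
    intro z
    simp only [map_add, map_mul, map_pow, eval_C, eval_X, eval_bidegreeCubic, binCubicPoly,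
      binQuad, Matrix.cons_val, ha0, ha1, ha2, ha3, hb0, hb1, hb2, hb3]
    ring
  rw [hfac]
  by_cases hdeg : l' = 0 ∧ l * c 2 - m * c 0 = 0
  · refine not_nonsingular_mul (z := ![0, 1, 0, 0]) (fun h0 => ?_) ?_ ?_
    · simpa using congrFun h0 1
    · simp
    · simp [hdeg.1]
  · refine not_nonsingular_mul (z := ![l' * c 2, -(l * c 2 - m * c 0), -l' * c 0, 0])
      (fun h0 => hdeg ?_) ?_ ?_
    · have e0 := congrFun h0 0
      have e1 := congrFun h0 1
      have e2 := congrFun h0 2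
      simp only [Matrix.cons_val, Pi.zero_apply] at e0 e1 e2
      refine ⟨?_, by linear_combination -e1⟩
      apply mul_left_cancel₀ hD
      linear_combination -c 1 * e0 - c 3 * e2
    · simp only [map_add, map_mul, eval_C, eval_X, Matrix.cons_val]
      ring
    · simp only [map_add, map_mul, eval_C, eval_X, Matrix.cons_val]
      ring

/-- The cross-ratio of four distinct points is real if and only if they lie on a circle or line. -/
lemma exists_crossRatio_eq_real_iff {v : Fin 4 → ℂ} (hv : Function.Injective v) :
    (∃ r : ℝ, (v 0 - v 2) * (v 1 - v 3) / ((v 0 - v 3) * (v 1 - v 2)) = (r : ℂ)) ↔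
      ∃ c : Fin 4 → ℂ, c ≠ 0 ∧ ∀ i,
        c 0 * (starRingEnd ℂ (v i) * v i) + c 1 * starRingEnd ℂ (v i) + c 2 * v i + c 3 = 0 := by
  let M : Matrix (Fin 4) (Fin 4) ℂ :=
    Matrix.of fun i => ![starRingEnd ℂ (v i) * v i, starRingEnd ℂ (v i), v i, 1]
  have hM : (∃ c : Fin 4 → ℂ, c ≠ 0 ∧ ∀ i,
      c 0 * (starRingEnd ℂ (v i) * v i) + c 1 * starRingEnd ℂ (v i) + c 2 * v i + c 3 = 0) ↔
      M.det = 0 := by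
    rw [← Matrix.exists_mulVec_eq_zero_iff]
    refine exists_congr fun c => and_congr_right fun _ => ?_
    rw [funext_iff]
    refine forall_congr' fun i => ?_
    simp only [M, Matrix.mulVec, dotProduct, Fin.sum_univ_four, Matrix.of_apply, Matrix.cons_val,
      Pi.zero_apply]
    rw [show ∀ a b : ℂ, a = b → (a = 0 ↔ b = 0) by rintro a _ rfl; rfl]
    ring
  rw [hM]
  have h03 : v 0 - v 3 ≠ 0 := sub_ne_zero.2 (hv.ne (by decide))
  have h12 : v 1 - v 2 ≠ 0 := sub_ne_zero.2 (hv.ne (by decide))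
  have hreal := Complex.conj_eq_iff_real
    (z := (v 0 - v 2) * (v 1 - v 3) / ((v 0 - v 3) * (v 1 - v 2)))
  rw [← hreal, map_div₀, div_eq_div_iff
    (by simpa only [ne_eq, map_eq_zero] using mul_ne_zero h03 h12) (mul_ne_zero h03 h12)]
  simp only [map_mul, map_sub]
  rw [← sub_eq_zero]
  simp [M, Matrix.det_succ_row_zero, Fin.sum_univ_succ, Fin.succAbove]
  constructor <;> intro h <;> linear_combination -h

/-- Given five distinct points `t₁,…,t₅` of `ℂ ⊆ S²`, there is a nonsingular cubic
surface containing the five twistor fibres `span{(0,tᵢ,0,1),(t̄ᵢ,0,1,0)}` iff no four of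
the points lie on a circle, i.e. iff every cross-ratio of four of them is non-real. -/
theorem nonsingular_cubic_through_five_fibres_iff (t : Fin 5 → ℂ)
    (ht : Function.Injective t) :
    (∃ f : MvPolynomial (Fin 4) ℂ, f ≠ 0 ∧ f.IsHomogeneous 3 ∧ Nonsingular f ∧
        ∀ i, VanishesOn f
          (Submodule.span ℂ
            {(![0, t i, 0, 1] : Fin 4 → ℂ), ![(starRingEnd ℂ) (t i), 0, 1, 0]})) ↔
      (∀ i j k l : Fin 5, i ≠ j → i ≠ k → i ≠ l → j ≠ k → j ≠ l → k ≠ l →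
        ∀ r : ℝ, (t i - t k) * (t j - t l) / ((t i - t l) * (t j - t k)) ≠ (r : ℂ)) := by
  have hconj : Function.Injective fun i => starRingEnd ℂ (t i) :=
    (starRingEnd ℂ).injective.comp ht
  have hfour : ∀ i j k l : Fin 5, i ≠ j → i ≠ k → i ≠ l → j ≠ k → j ≠ l → k ≠ l →
      Function.Injective ![i, j, k, l] := by
    unfold Function.Injective
    decide
  constructor
  · rintro ⟨f, -, hf, hns, hv⟩ i j k l hij hik hil hjk hjl hkl r hr
    have he := hfour i j k l hij hik hil hjk hjl hkl
    obtain ⟨c, hc, hc0⟩ := (exists_crossRatio_eq_real_iff (ht.comp he)).1 ⟨r, by simpa using hr⟩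
    refine not_nonsingular_of_conic (hconj.comp he) (ht.comp he) hc hc0 hf (fun m s r => ?_) hns
    refine hv (![i, j, k, l] m) _ (Submodule.mem_span_pair.2 ⟨r, s, ?_⟩)
    funext n
    fin_cases n <;> simp
  · intro hcr
    have hno : NoFourOnConic (fun i => starRingEnd ℂ (t i)) t := by
      intro i j k l hij hik hil hjk hjl hkl c hc
      by_contra hc0
      have he := hfour i j k l hij hik hil hjk hjl hkl
      obtain ⟨r, hr⟩ := (exists_crossRatio_eq_real_iff (ht.comp he)).2 ⟨c, hc0, fun m => by
        apply hc
        fin_cases m <;> simp⟩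
      exact hcr i j k l hij hik hil hjk hjl hkl r (by simpa using hr)
    obtain ⟨A, B, h0, hP⟩ := exists_binQuad_pair (fun i => starRingEnd ℂ (t i)) t
    obtain ⟨A', B', h0', hQ⟩ := exists_binQuad_pair t fun i => starRingEnd ℂ (t i)
    have hns := FivePointPair.nonsingular ⟨hconj, ht, hno, h0, h0', hP, hQ⟩
    refine ⟨bidegreeCubic A B A' B', fun hzero => ?_, isHomogeneous_bidegreeCubic A B A' B', hns,
      fun i z hz => ?_⟩
    · rw [hzero] at hns
      obtain ⟨i, hi⟩ := hns 1 one_ne_zero (map_zero _)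
      simp at hi
    · obtain ⟨r, s, rfl⟩ := Submodule.mem_span_pair.1 hz
      have e := hP i
      have e' := hQ i
      rw [eval_bidegreeCubic]
      simp [binQuad] at e e' ⊢
      linear_combination s ^ 2 * r * e + s * r ^ 2 * e'
end
end

section
/- If a nonsingular cubic surface in ℙ³(ℂ) contains five pairwise skew lines, then the five lines are collinear: there exists a further line in ℙ³(ℂ) meeting all five of them. -/
noncomputable section

open MvPolynomial

/-- A cubic form is the restriction to the diagonal of a symmetric trilinear form. -/
lemma exists_trilinear_of_isHomogeneous_three (f : MvPolynomial (Fin 4) ℂ)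
    (hhom : f.IsHomogeneous 3) :
    ∃ T : (Fin 4 → ℂ) →ₗ[ℂ] (Fin 4 → ℂ) →ₗ[ℂ] (Fin 4 → ℂ) →ₗ[ℂ] ℂ,
      (∀ u v w, T u v w = T v u w) ∧ (∀ u v w, T u v w = T u w v) ∧
      (∀ z, T z z z = 6 * eval z f) ∧
      ∀ z i, T z z (Pi.single i 1) = 2 * eval z (pderiv i f) := by
  have euler : ∀ (g : MvPolynomial (Fin 4) ℂ) (n : ℕ), g.IsHomogeneous n → ∀ z : Fin 4 → ℂ,
      ∑ i, z i * eval z (pderiv i g) = n * eval z g := by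
    intro g n hg z
    simpa using congrArg (eval z) hg.sum_X_mul_pderiv
  have comm : ∀ (i j : Fin 4) (g : MvPolynomial (Fin 4) ℂ),
      pderiv i (pderiv j g) = pderiv j (pderiv i g) := by
    intro i j g
    let D (i : Fin 4) : Derivation ℂ (MvPolynomial (Fin 4) ℂ) (MvPolynomial (Fin 4) ℂ) := pderiv i
    have h : ⁅D i, D j⁆ = 0 := by
      apply MvPolynomial.derivation_ext
      intro k
      simp [D, Derivation.commutator_apply, pderiv_X, Pi.single_apply, apply_ite]
    have := congrArg (fun d => d g) h
    simpa [D, Derivation.commutator_apply, sub_eq_zero] using this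
  have h1 : ∀ i, (pderiv i f).IsHomogeneous 2 := fun i => hhom.pderiv
  have h2 : ∀ i j, (pderiv i (pderiv j f)).IsHomogeneous 1 := fun i j => (h1 j).pderiv
  have h3 : ∀ i j k, (pderiv i (pderiv j (pderiv k f))).IsHomogeneous 0 :=
    fun i j k => (h2 j k).pderiv
  let c : Fin 4 → Fin 4 → Fin 4 → ℂ := fun i j k =>
    eval 0 (pderiv i (pderiv j (pderiv k f)))
  have hc : ∀ i j k z, eval z (pderiv i (pderiv j (pderiv k f))) = c i j k := by
    intro i j k z
    have h := h3 i j k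
    rw [← totalDegree_zero_iff_isHomogeneous, totalDegree_eq_zero_iff_eq_C] at h
    simp only [c]
    rw [h]
    simp
  let T : (Fin 4 → ℂ) →ₗ[ℂ] (Fin 4 → ℂ) →ₗ[ℂ] (Fin 4 → ℂ) →ₗ[ℂ] ℂ :=
    ∑ i, ∑ j, ∑ k, c i j k • (LinearMap.proj i).smulRight
      ((LinearMap.proj j).smulRight (LinearMap.proj k : (Fin 4 → ℂ) →ₗ[ℂ] ℂ))
  have hT : ∀ u v w, T u v w = ∑ i, ∑ j, ∑ k, c i j k * (u i * (v j * w k)) := by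
    intro u v w
    simp [T, LinearMap.sum_apply]
  have hzz : ∀ z i, T z z (Pi.single i 1) = 2 * eval z (pderiv i f) := by
    intro z k
    have e1 := euler _ 2 (h1 k) z
    have e2 := fun j => euler _ 1 (h2 j k) z
    rw [hT]
    simp only [hc, Nat.cast_one, one_mul, Nat.cast_ofNat] at e1 e2
    rw [← e1, Finset.sum_comm]
    refine Finset.sum_congr rfl fun j _ => ?_
    rw [← e2, Finset.mul_sum]
    refine Finset.sum_congr rfl fun i _ => ?_
    simp [Pi.single_apply]
    ring
  refine ⟨T, ?_, ?_, ?_, hzz⟩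
  · intro u v w
    rw [hT, hT, Finset.sum_comm]
    refine Finset.sum_congr rfl fun j _ => Finset.sum_congr rfl fun i _ =>
      Finset.sum_congr rfl fun k _ => ?_
    rw [show c i j k = c j i k by simp only [c]; rw [comm]]
    ring
  · intro u v w
    rw [hT, hT]
    refine Finset.sum_congr rfl fun i _ => ?_
    rw [Finset.sum_comm]
    refine Finset.sum_congr rfl fun j _ => Finset.sum_congr rfl fun k _ => ?_
    rw [show c i k j = c i j k by simp only [c]; rw [comm k j]]
    ring
  · intro z
    have hz : z = ∑ i, z i • (Pi.single i 1 : Fin 4 → ℂ) := by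
      simpa using (pi_eq_sum_univ' z)
    have e := euler _ 3 hhom z
    calc T z z z = T z z (∑ i, z i • (Pi.single i 1 : Fin 4 → ℂ)) := by rw [← hz]
      _ = 2 * ∑ i, z i * eval z (pderiv i f) := by
        rw [map_sum, Finset.mul_sum]
        refine Finset.sum_congr rfl fun i _ => ?_
        rw [map_smul, hzz, smul_eq_mul]
        ring
      _ = 6 * eval z f := by rw [e]; push_cast; ring

section Trilinear

variable {U V : Type*} [AddCommGroup U] [Module ℂ U] [AddCommGroup V] [Module ℂ V]

lemma exists_eq_smul_add_smul (hV : Module.finrank ℂ V = 2) {v w : V}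
    (h : LinearIndependent ℂ ![v, w]) (x : V) : ∃ a b : ℂ, x = a • v + b • w := by
  have : FiniteDimensional ℂ V := Module.finite_of_finrank_pos (by omega)
  have hs := h.span_eq_top_of_card_eq_finrank' (by simp [hV])
  have hx : x ∈ Submodule.span ℂ (Set.range ![v, w]) := hs ▸ Submodule.mem_top
  rw [Matrix.range_cons_cons_empty, Submodule.mem_span_pair] at hx
  obtain ⟨a, b, hab⟩ := hx
  exact ⟨a, b, hab.symm⟩

lemma exists_linearIndependent_pair_of_finrank_two (hV : Module.finrank ℂ V = 2) {v : V}
    (hv : v ≠ 0) : ∃ w, LinearIndependent ℂ ![v, w] :=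
  exists_linearIndependent_pair_of_one_lt_finrank (by omega) hv

/-- Polarization of a symmetric trilinear form along a linear family of isotropic vectors. -/
lemma trilinear_polarize (T : U →ₗ[ℂ] U →ₗ[ℂ] U →ₗ[ℂ] ℂ)
    (s₁ : ∀ u v w, T u v w = T v u w) (s₂ : ∀ u v w, T u v w = T u w v)
    (R : V →ₗ[ℂ] U) (hR : ∀ x, T (R x) (R x) (R x) = 0) (x y : V) :
    T (R x) (R x) (R y) = 0 := by
  have h1 := hR (x + y)
  have h2 := hR (x - y)
  have h3 := hR x
  have h4 := hR y
  simp only [map_add, map_sub, LinearMap.add_apply, LinearMap.sub_apply] at h1 h2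
  rw [s₂ (R x) (R y) (R x), s₁ (R y) (R x) (R x), s₂ (R x) (R y) (R x), s₁ (R y) (R x) (R y),
    s₂ (R y) (R y) (R x), s₁ (R y) (R x) (R y)] at h1 h2
  linear_combination (h1 - h2 - 2 * h4) / 6

/-- Two linear maps `p q : V → U` whose images are complementary, together with a symmetric
trilinear form vanishing on the diagonal of the images of `p`, `q` and `p + q`: the cubic form
`x ↦ T (p x) (p x) (q x)` has no multiple root when the form is nonsingular. -/
lemma cubic_no_multiple_root (hV : Module.finrank ℂ V = 2)
    (T : U →ₗ[ℂ] U →ₗ[ℂ] U →ₗ[ℂ] ℂ)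
    (s₁ : ∀ u v w, T u v w = T v u w) (s₂ : ∀ u v w, T u v w = T u w v)
    (hns : ∀ z, z ≠ 0 → ∃ w, T z z w ≠ 0) (p q : V →ₗ[ℂ] U)
    (hinj : ∀ x y, p x + q y = 0 → x = 0 ∧ y = 0) (hsurj : ∀ z, ∃ x y, z = p x + q y)
    (hp : ∀ x, T (p x) (p x) (p x) = 0) (hq : ∀ x, T (q x) (q x) (q x) = 0)
    (hpq : ∀ x, T (p x + q x) (p x + q x) (p x + q x) = 0)
    {v w : V} (hvw : LinearIndependent ℂ ![v, w]) (hc : T (p v) (p v) (q v) = 0)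
    (hd : 2 * T (p v) (p w) (q v) + T (p v) (p v) (q w) = 0) : False := by
  have hv : v ≠ 0 := by simpa using hvw.ne_zero 0
  have hp' := trilinear_polarize T s₁ s₂ p hp v
  have hq' := trilinear_polarize T s₁ s₂ q hq v
  have hr := trilinear_polarize T s₁ s₂ (p + q) (by simpa using hpq) v
  have hrw := hr w
  have hrv := hr v
  simp only [map_add, LinearMap.add_apply] at hrw hrv
  have hpp := hp' w
  have hqq := hq' w
  have hppv := hp' v
  have hqqv := hq' v
  have key : ∃ s t : ℂ, (s ≠ 0 ∨ t ≠ 0) ∧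
      s * T (p v) (q v) (p w) = t * T (p v) (q v) (q w) := by
    by_cases h : T (p v) (q v) (p w) = 0
    · exact ⟨1, 0, by simp, by simp [h]⟩
    · exact ⟨T (p v) (q v) (q w), T (p v) (q v) (p w), .inr h, mul_comm _ _⟩
  obtain ⟨s, t, hst, hk⟩ := key
  have hz : p (s • v) + q (t • v) ≠ 0 := by
    intro h
    have := hinj _ _ h
    simp [hv] at this
    grind
  obtain ⟨u, hu⟩ := hns _ hz
  apply hu
  obtain ⟨x, y, rfl⟩ := hsurj u
  obtain ⟨a, b, rfl⟩ := exists_eq_smul_add_smul hV hvw x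
  obtain ⟨a', b', rfl⟩ := exists_eq_smul_add_smul hV hvw y
  simp only [map_add, map_smul, LinearMap.add_apply, LinearMap.smul_apply, smul_eq_mul]
  simp only [s₁, s₂] at hc hd hk hpp hqq hppv hqqv hrw hrv ⊢
  linear_combination (2 * b * t - 2 * b' * s) * hk + b * s ^ 2 * hpp + b' * t ^ 2 * hqq
    + b' * s ^ 2 * hd + b * t ^ 2 * (hrw - hd - hpp - hqq)
    + a * s ^ 2 * hppv + (a * 2 * s * t + a' * s ^ 2) * hc
    + (a * t ^ 2 + a' * 2 * s * t) * ((hrv - hppv - hqqv) / 3 - hc) + a' * t ^ 2 * hqqv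


/-- If the graph `{p x + q (M x)}` of `M` consists of isotropic vectors and is skew to the images
of `p` and `p + q`, then eigenvectors of `M` are roots of the cubic `x ↦ T (p x) (p x) (q x)`. -/
lemma cubic_eq_zero_of_eigenvector
    (T : U →ₗ[ℂ] U →ₗ[ℂ] U →ₗ[ℂ] ℂ)
    (s₁ : ∀ u v w, T u v w = T v u w) (s₂ : ∀ u v w, T u v w = T u w v)
    (p q : V →ₗ[ℂ] U)
    (hp : ∀ x, T (p x) (p x) (p x) = 0) (hq : ∀ x, T (q x) (q x) (q x) = 0)
    (hpq : ∀ x, T (p x + q x) (p x + q x) (p x + q x) = 0)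
    (M : V →ₗ[ℂ] V) (hM : ∀ x, T (p x + q (M x)) (p x + q (M x)) (p x + q (M x)) = 0)
    {v : V} {l : ℂ} (hl : M v = l • v) (hl0 : l ≠ 0) (hl1 : l ≠ 1) :
    T (p v) (p v) (q v) = 0 := by
  have h1 := hp v
  have h2 := hq v
  have h3 := hpq v
  have h4 := hM v
  rw [hl] at h4
  simp only [map_add, map_smul, LinearMap.add_apply, LinearMap.smul_apply, smul_eq_mul] at h3 h4
  simp only [s₁, s₂] at h1 h2 h3 h4 ⊢
  have : l * (1 - l) ≠ 0 := mul_ne_zero hl0 (sub_ne_zero.2 hl1.symm)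
  apply mul_left_cancel₀ this
  linear_combination (h4 - h1 - l ^ 3 * h2) / 3 - l ^ 2 * (h3 - h1 - h2) / 3

/-- Under the hypotheses of `cubic_no_multiple_root`, the map `M` whose graph is a further
isotropic line is diagonalizable. -/
lemma exists_linearIndependent_eigenvectors (hV : Module.finrank ℂ V = 2)
    (T : U →ₗ[ℂ] U →ₗ[ℂ] U →ₗ[ℂ] ℂ)
    (s₁ : ∀ u v w, T u v w = T v u w) (s₂ : ∀ u v w, T u v w = T u w v)
    (hns : ∀ z, z ≠ 0 → ∃ w, T z z w ≠ 0) (p q : V →ₗ[ℂ] U)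
    (hinj : ∀ x y, p x + q y = 0 → x = 0 ∧ y = 0) (hsurj : ∀ z, ∃ x y, z = p x + q y)
    (hp : ∀ x, T (p x) (p x) (p x) = 0) (hq : ∀ x, T (q x) (q x) (q x) = 0)
    (hpq : ∀ x, T (p x + q x) (p x + q x) (p x + q x) = 0)
    (M : V →ₗ[ℂ] V) (hM : ∀ x, T (p x + q (M x)) (p x + q (M x)) (p x + q (M x)) = 0)
    (hM0 : ∀ x, M x = 0 → x = 0) (hM1 : ∀ x, M x = x → x = 0) :
    ∃ v w : V, LinearIndependent ℂ ![v, w] ∧ T (p v) (p v) (q v) = 0 ∧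
      T (p w) (p w) (q w) = 0 ∧ ∃ l m : ℂ, M v = l • v ∧ M w = m • w := by
  have : FiniteDimensional ℂ V := Module.finite_of_finrank_pos (by omega)
  have : Nontrivial V := Module.nontrivial_of_finrank_pos (R := ℂ) (by omega)
  have root : ∀ (x : V) (l : ℂ), x ≠ 0 → M x = l • x → T (p x) (p x) (q x) = 0 := by
    intro x l hx hl
    refine cubic_eq_zero_of_eigenvector T s₁ s₂ p q hp hq hpq M hM hl ?_ ?_
    · rintro rfl
      exact hx (hM0 x (by simpa using hl))
    · rintro rfl
      exact hx (hM1 x (by simpa using hl))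
  suffices h : ∃ v w : V, LinearIndependent ℂ ![v, w] ∧ ∃ l m : ℂ, M v = l • v ∧ M w = m • w by
    obtain ⟨v, w, hi, l, m, hl, hm⟩ := h
    exact ⟨v, w, hi, root v l (by simpa using hi.ne_zero 0) hl,
      root w m (by simpa using hi.ne_zero 1) hm, l, m, hl, hm⟩
  obtain ⟨l, hl⟩ := Module.End.exists_eigenvalue M
  obtain ⟨v, hv⟩ := hl.exists_hasEigenvector
  have hlv : M v = l • v := hv.apply_eq_smul
  obtain ⟨w, hvw⟩ := exists_linearIndependent_pair_of_finrank_two hV hv.2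
  obtain ⟨g, m, hg⟩ := exists_eq_smul_add_smul hV hvw (M w)
  by_cases hml : m = l
  · subst hml
    have hm0 : m ≠ 0 := by
      rintro rfl
      exact hv.2 (hM0 v (by simpa using hlv))
    have hm1 : m ≠ 1 := by
      rintro rfl
      exact hv.2 (hM1 v (by simpa using hlv))
    exfalso
    have hc := root v m hv.2 hlv
    refine cubic_no_multiple_root hV T s₁ s₂ hns p q hinj hsurj hp hq hpq hvw hc ?_
    have h := trilinear_polarize T s₁ s₂ (p + q ∘ₗ M) (by simpa using hM) v w
    have hr := trilinear_polarize T s₁ s₂ (p + q) (by simpa using hpq) v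
    have hrv := hr v
    have hrw := hr w
    have hppv := hp v
    have hqqv := hq v
    have hppw := trilinear_polarize T s₁ s₂ p hp v w
    have hqqw := trilinear_polarize T s₁ s₂ q hq v w
    simp only [LinearMap.add_apply, LinearMap.comp_apply, hlv, hg, map_add, map_smul,
      LinearMap.smul_apply, smul_eq_mul] at h hrv hrw
    simp only [s₁, s₂] at h hrv hrw hppv hqqv hppw hqqw hc ⊢
    have : m * (1 - m) ≠ 0 := mul_ne_zero hm0 (sub_ne_zero.2 hm1.symm)
    apply mul_left_cancel₀ this
    linear_combination h - m ^ 2 * (hrw - hppw - hqqw) - hppw - m ^ 3 * hqqw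
      - g * m ^ 2 * hqqv - g * hc - 2 * g * m * ((hrv - hppv - hqqv) / 3 - hc)
  · refine ⟨v, w + (g / (m - l)) • v, ?_, l, m, hlv, ?_⟩
    · rw [LinearIndependent.pair_iff] at hvw ⊢
      intro s t h
      have := hvw (s + t * (g / (m - l))) t (by rw [← h]; module)
      grind
    · have : m - l ≠ 0 := sub_ne_zero.2 hml
      rw [map_add, map_smul, hg, hlv]
      match_scalars <;> field_simp
      ring

/-- The maps whose graphs are two further isotropic lines have a common eigenvector. -/
lemma exists_common_eigenvector (hV : Module.finrank ℂ V = 2)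
    (T : U →ₗ[ℂ] U →ₗ[ℂ] U →ₗ[ℂ] ℂ)
    (s₁ : ∀ u v w, T u v w = T v u w) (s₂ : ∀ u v w, T u v w = T u w v)
    (hns : ∀ z, z ≠ 0 → ∃ w, T z z w ≠ 0) (p q : V →ₗ[ℂ] U)
    (hinj : ∀ x y, p x + q y = 0 → x = 0 ∧ y = 0) (hsurj : ∀ z, ∃ x y, z = p x + q y)
    (hp : ∀ x, T (p x) (p x) (p x) = 0) (hq : ∀ x, T (q x) (q x) (q x) = 0)
    (hpq : ∀ x, T (p x + q x) (p x + q x) (p x + q x) = 0)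
    (M N : V →ₗ[ℂ] V) (hM : ∀ x, T (p x + q (M x)) (p x + q (M x)) (p x + q (M x)) = 0)
    (hM0 : ∀ x, M x = 0 → x = 0) (hM1 : ∀ x, M x = x → x = 0)
    (hN : ∀ x, T (p x + q (N x)) (p x + q (N x)) (p x + q (N x)) = 0)
    (hN0 : ∀ x, N x = 0 → x = 0) (hN1 : ∀ x, N x = x → x = 0) :
    ∃ v : V, v ≠ 0 ∧ ∃ l m : ℂ, M v = l • v ∧ N v = m • v := by
  obtain ⟨v, w, hvw, hcv, hcw, l, m, hl, hm⟩ := exists_linearIndependent_eigenvectors hV T s₁ s₂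
    hns p q hinj hsurj hp hq hpq M hM hM0 hM1
  obtain ⟨x, y, hxy, hcx, hcy, l', m', hl', hm'⟩ := exists_linearIndependent_eigenvectors hV T
    s₁ s₂ hns p q hinj hsurj hp hq hpq N hN hN0 hN1
  by_contra! hcon
  have eig : ∀ (z : V) (r a b : ℂ), N z = r • z → z = a • v + b • w →
      T (p z) (p z) (q z) = 0 → z ≠ 0 →
      a * (2 * T (p v) (p w) (q v) + T (p v) (p v) (q w)) +
        b * (2 * T (p w) (p v) (q w) + T (p w) (p w) (q v)) = 0 := by
    intro z r a b hr hz hc hz0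
    have ha : a ≠ 0 := by
      rintro rfl
      refine hcon z hz0 m r ?_ hr
      rw [hz, zero_smul, zero_add, map_smul, hm, smul_comm]
    have hb : b ≠ 0 := by
      rintro rfl
      refine hcon z hz0 l r ?_ hr
      rw [hz, zero_smul, add_zero, map_smul, hl, smul_comm]
    rw [hz] at hc
    simp only [map_add, map_smul, LinearMap.add_apply, LinearMap.smul_apply, smul_eq_mul] at hc
    simp only [s₁] at hc hcv hcw ⊢
    apply mul_left_cancel₀ (mul_ne_zero ha hb)
    linear_combination hc - a ^ 3 * hcv - b ^ 3 * hcw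
  obtain ⟨a, b, hx⟩ := exists_eq_smul_add_smul hV hvw x
  obtain ⟨c, d, hy⟩ := exists_eq_smul_add_smul hV hvw y
  have e1 := eig x l' a b hl' hx hcx (by simpa using hxy.ne_zero 0)
  have e2 := eig y m' c d hm' hy hcy (by simpa using hxy.ne_zero 1)
  refine cubic_no_multiple_root hV T s₁ s₂ hns p q hinj hsurj hp hq hpq hvw hcv ?_
  have hdet : a * d - b * c ≠ 0 := by
    intro h
    rw [LinearIndependent.pair_iff] at hxy
    have h1 := hxy d (-b) (by
      rw [hx, hy]
      match_scalars
      · linear_combination h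
      · ring)
    have h2 := hxy c (-a) (by
      rw [hx, hy]
      match_scalars
      · ring
      · linear_combination -h)
    have hb : b = 0 := by simpa using h1.2
    have ha : a = 0 := by simpa using h2.2
    simpa using (hxy 1 0 (by simp [hx, ha, hb])).1
  apply mul_left_cancel₀ hdet
  linear_combination d * e1 - b * e2

/-- A plane meeting the image of `q` trivially is a graph in the decomposition `p ⊕ q`. -/
lemma exists_graph_mem (hV : Module.finrank ℂ V = 2) (p q : V →ₗ[ℂ] U)
    (hinj : ∀ x y, p x + q y = 0 → x = 0 ∧ y = 0) (hsurj : ∀ z, ∃ x y, z = p x + q y)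
    (W : Submodule ℂ U) (hW : Module.finrank ℂ W = 2) (hq : ∀ y, q y ∈ W → q y = 0) :
    ∃ M : V →ₗ[ℂ] V, ∀ x, p x + q (M x) ∈ W := by
  have : FiniteDimensional ℂ V := Module.finite_of_finrank_pos (by omega)
  have : FiniteDimensional ℂ W := Module.finite_of_finrank_pos (by omega)
  let E : (V × V) ≃ₗ[ℂ] U := LinearEquiv.ofBijective (p.coprod q) ⟨by
    rw [← LinearMap.ker_eq_bot, LinearMap.ker_eq_bot']
    rintro ⟨x, y⟩ h
    simpa using hinj x y (by simpa using h), fun z => by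
    obtain ⟨x, y, rfl⟩ := hsurj z
    exact ⟨(x, y), by simp⟩⟩
  have hE : ∀ z, p (E.symm z).1 + q (E.symm z).2 = z := fun z => E.apply_symm_apply z
  let π : W →ₗ[ℂ] V := LinearMap.fst ℂ V V ∘ₗ E.symm.toLinearMap ∘ₗ W.subtype
  have hπ : Function.Injective π := by
    rw [← LinearMap.ker_eq_bot, LinearMap.ker_eq_bot']
    intro z hz
    have h := hE z
    have h0 : (E.symm (z : U)).1 = 0 := hz
    rw [h0, map_zero, zero_add] at h
    have := hq (E.symm (z : U)).2 (by rw [h]; exact z.2)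
    exact Subtype.ext (h.symm.trans this)
  let e : W ≃ₗ[ℂ] V := LinearMap.linearEquivOfInjective π hπ (hW.trans hV.symm)
  refine ⟨LinearMap.snd ℂ V V ∘ₗ E.symm.toLinearMap ∘ₗ W.subtype ∘ₗ e.symm.toLinearMap,
    fun x => ?_⟩
  have h1 : (E.symm (e.symm x : U)).1 = x := e.apply_symm_apply x
  have h := hE (e.symm x : U)
  rw [h1] at h
  change p x + q (E.symm (e.symm x : U)).2 ∈ W
  rw [h]
  exact (e.symm x).2

end Trilinear

/-- Five pairwise skew lines on a nonsingular cubic surface are collinear: some further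
line meets all five of them. -/
theorem five_skew_lines_on_cubic_collinear (f : MvPolynomial (Fin 4) ℂ) (hf0 : f ≠ 0)
    (hhom : f.IsHomogeneous 3) (hns : Nonsingular f)
    (W : Fin 5 → Submodule ℂ (Fin 4 → ℂ)) (hW : ∀ i, IsLine (W i))
    (hv : ∀ i, VanishesOn f (W i))
    (hskew : ∀ i j, i ≠ j → W i ⊓ W j = ⊥) :
    ∃ K : Submodule ℂ (Fin 4 → ℂ), IsLine K ∧ ∀ i, K ⊓ W i ≠ ⊥ := by
  obtain ⟨T, s₁, s₂, hT, hdT⟩ := exists_trilinear_of_isHomogeneous_three f hhom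
  have hns' : ∀ z, z ≠ 0 → ∃ w, T z z w ≠ 0 := by
    intro z hz
    by_contra! h
    obtain ⟨i, hi⟩ := hns z hz (by simpa [h] using hT z)
    exact hi (by simpa [h] using hdT z i)
  have iso : ∀ i, ∀ z ∈ W i, T z z z = 0 := fun i z hz => by rw [hT, hv i z hz, mul_zero]
  have skew : ∀ i j, i ≠ j → ∀ z, z ∈ W i → z ∈ W j → z = 0 := fun i j hij z hi hj => by
    have : z ∈ W i ⊓ W j := ⟨hi, hj⟩
    simpa [hskew i j hij] using this
  have hV : Module.finrank ℂ (W 0) = 2 := hW 0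
  let e : W 0 ≃ₗ[ℂ] W 1 := LinearEquiv.ofFinrankEq _ _ ((hW 0).trans (hW 1).symm)
  let p : W 0 →ₗ[ℂ] (Fin 4 → ℂ) := (W 0).subtype
  let q₀ : W 0 →ₗ[ℂ] (Fin 4 → ℂ) := (W 1).subtype ∘ₗ e.toLinearMap
  have hpm : ∀ x, p x ∈ W 0 := fun x => x.2
  have hq₀m : ∀ x, q₀ x ∈ W 1 := fun x => (e x).2
  have hp0 : ∀ x, p x = 0 → x = 0 := fun x hx => Subtype.ext hx
  have hq₀0 : ∀ x, q₀ x = 0 → x = 0 := fun x hx =>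
    e.map_eq_zero_iff.1 (Subtype.ext hx)
  have hinj₀ : ∀ x y, p x + q₀ y = 0 → x = 0 ∧ y = 0 := by
    intro x y h
    have hx : p x = 0 := skew 0 1 (by decide) _ (hpm x) (by
      rw [eq_neg_of_add_eq_zero_left h]
      exact neg_mem (hq₀m y))
    exact ⟨hp0 x hx, hq₀0 y (by simpa [hx] using h)⟩
  have hsurj₀ : ∀ z, ∃ x y, z = p x + q₀ y := by
    have hi : Function.Injective (p.coprod q₀) := by
      rw [← LinearMap.ker_eq_bot, LinearMap.ker_eq_bot']
      rintro ⟨x, y⟩ h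
      simpa using hinj₀ x y (by simpa using h)
    have hs := (LinearMap.injective_iff_surjective_of_finrank_eq_finrank
      (by simp [hV])).1 hi
    intro z
    obtain ⟨⟨x, y⟩, h⟩ := hs z
    exact ⟨x, y, by simpa using h.symm⟩
  obtain ⟨φ, hφ⟩ := exists_graph_mem hV p q₀ hinj₀ hsurj₀ (W 2) (hW 2)
    fun y hy => skew 1 2 (by decide) _ (hq₀m y) hy
  have hφ0 : ∀ x, φ x = 0 → x = 0 := fun x hx =>
    hp0 x (skew 0 2 (by decide) _ (hpm x) (by simpa [hx] using hφ x))
  have hφs : Function.Surjective φ := LinearMap.injective_iff_surjective.1 (by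
    rw [← LinearMap.ker_eq_bot, LinearMap.ker_eq_bot']
    exact hφ0)
  let q : W 0 →ₗ[ℂ] (Fin 4 → ℂ) := q₀ ∘ₗ φ
  have hqm : ∀ x, q x ∈ W 1 := fun x => hq₀m _
  have hinj : ∀ x y, p x + q y = 0 → x = 0 ∧ y = 0 := fun x y h =>
    ⟨(hinj₀ _ _ h).1, hφ0 y (hinj₀ _ _ h).2⟩
  have hsurj : ∀ z, ∃ x y, z = p x + q y := fun z => by
    obtain ⟨x, y, rfl⟩ := hsurj₀ z
    obtain ⟨y, rfl⟩ := hφs y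
    exact ⟨x, y, rfl⟩
  have graph : ∀ i, i ≠ 0 → i ≠ 1 → i ≠ 2 → ∃ M : W 0 →ₗ[ℂ] W 0, (∀ x, p x + q (M x) ∈ W i) ∧
      (∀ x, M x = 0 → x = 0) ∧ (∀ x, M x = x → x = 0) := by
    intro i h0 h1 h2
    obtain ⟨M, hM⟩ := exists_graph_mem hV p q hinj hsurj (W i) (hW i)
      fun y hy => skew i 1 h1 _ hy (hqm y)
    refine ⟨M, hM, fun x hx => hp0 x (skew i 0 h0 _ (by simpa [hx] using hM x) (hpm x)),
      fun x hx => ?_⟩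
    have h := hM x
    rw [hx] at h
    exact (hinj x x (skew i 2 h2 _ h (hφ x))).1
  obtain ⟨M, hM, hM0, hM1⟩ := graph 3 (by decide) (by decide) (by decide)
  obtain ⟨N, hN, hN0, hN1⟩ := graph 4 (by decide) (by decide) (by decide)
  obtain ⟨v, hv0, l, m, hl, hm⟩ := exists_common_eigenvector hV T s₁ s₂ hns' p q hinj hsurj
    (fun x => iso 0 _ (hpm x)) (fun x => iso 1 _ (hqm x)) (fun x => iso 2 _ (hφ x))
    M N (fun x => iso 3 _ (hM x)) hM0 hM1 (fun x => iso 4 _ (hN x)) hN0 hN1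
  have hind : LinearIndependent ℂ ![p v, q v] := by
    rw [LinearIndependent.pair_iff]
    intro s t h
    have := hinj (s • v) (t • v) (by simpa using h)
    simpa [hv0] using this
  have hmem : ∀ s t : ℂ, s • p v + t • q v ∈ Submodule.span ℂ (Set.range ![p v, q v]) := by
    intro s t
    rw [Matrix.range_cons_cons_empty, Submodule.mem_span_pair]
    exact ⟨s, t, rfl⟩
  have meet : ∀ i (s t : ℂ), s • p v + t • q v ∈ W i → (s ≠ 0 ∨ t ≠ 0) →
      Submodule.span ℂ (Set.range ![p v, q v]) ⊓ W i ≠ ⊥ := by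
    intro i s t hi hst
    rw [Submodule.ne_bot_iff]
    refine ⟨_, ⟨hmem s t, hi⟩, fun h => ?_⟩
    have := LinearIndependent.pair_iff.1 hind s t h
    tauto
  refine ⟨Submodule.span ℂ (Set.range ![p v, q v]), by
    simpa [IsLine] using finrank_span_eq_card hind, fun i => ?_⟩
  fin_cases i
  · exact meet 0 1 0 (by simpa using hpm v) (by simp)
  · exact meet 1 0 1 (by simpa using hqm v) (by simp)
  · exact meet 2 1 1 (by simpa [q] using hφ v) (by simp)
  · exact meet 3 1 l (by simpa [hl] using hM v) (by simp)
  · exact meet 4 1 m (by simpa [hm] using hN v) (by simp)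
end
end

section
/- The group of projective symmetries of the Fermat cubic surface is finite of order 648: the subgroup of PGL(4,ℂ) consisting of projective transformations mapping the zero locus of z₁³ + z₂³ + z₃³ + z₄³ in ℙ³(ℂ) onto itself has exactly 648 elements (it is generated by permutations of the coordinates and by multiplication of individual coordinates by cube roots of unity). -/
noncomputable section

open MvPolynomial

/-- The zero locus of the Fermat cubic `z₁³ + z₂³ + z₃³ + z₄³` in `ℙ³(ℂ)`. -/
def fermatLocus : Set (Projectivization ℂ (Fin 4 → ℂ)) :=
  {p | eval p.rep (X 0 ^ 3 + X 1 ^ 3 + X 2 ^ 3 + X 3 ^ 3 : MvPolynomial (Fin 4) ℂ) = 0}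

theorem mk_mem_fermatLocus_iff (v : Fin 4 → ℂ) (hv : v ≠ 0) :
    Projectivization.mk ℂ v hv ∈ fermatLocus ↔ ∑ k, v k ^ 3 = 0 := by
  obtain ⟨a, ha⟩ := Projectivization.exists_smul_eq_mk_rep ℂ v hv
  have ha0 : (a : ℂ) ≠ 0 := a.ne_zero
  have key : ∑ k, ((a : ℂ) * v k) ^ 3 = (a : ℂ) ^ 3 * ∑ k, v k ^ 3 := by
    simp only [mul_pow, Finset.mul_sum]
  simp only [fermatLocus, Set.mem_ofPred_eq, ← ha, map_add, map_pow, eval_X, Pi.smul_apply,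
    Units.smul_def, smul_eq_mul]
  rw [Fin.sum_univ_four] at key
  rw [key, mul_eq_zero, or_iff_right (pow_ne_zero 3 ha0)]

theorem exists_primitive_cube_root : ∃ w : ℂ, w ^ 2 + w + 1 = 0 := by
  obtain ⟨s, hs⟩ := IsAlgClosed.exists_pow_nat_eq (-3 : ℂ) (n := 2) (by norm_num)
  exact ⟨(-1 + s) / 2, by linear_combination hs / 4⟩

/-- If a linear map preserves the cone over the Fermat cubic, then its cubic form has no monomials
of the shape `u² z_m`. -/
theorem sum_sq_mul_eq_zero (g : (Fin 4 → ℂ) →ₗ[ℂ] (Fin 4 → ℂ))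
    (hg : ∀ v, ∑ k, v k ^ 3 = 0 → ∑ k, g v k ^ 3 = 0) (m : Fin 4) (u : Fin 4 → ℂ)
    (hum : u m = 0) (hu : ∑ k, u k ^ 3 ≠ 0) :
    ∑ k, g u k ^ 2 * g (Pi.single m 1) k = 0 := by
  obtain ⟨s, hs⟩ := IsAlgClosed.exists_pow_nat_eq (-∑ k, u k ^ 3) (n := 3) (by norm_num)
  obtain ⟨w, hw⟩ := exists_primitive_cube_root
  have hw3 : w ^ 3 = 1 := by linear_combination (w - 1) * hw
  have hs0 : s ≠ 0 := by
    rintro rfl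
    exact hu (by simpa using hs)
  have expand (t : ℂ) (ht : t ^ 3 = s ^ 3) :
      ∑ k, g u k ^ 3 + 3 * t * ∑ k, g u k ^ 2 * g (Pi.single m 1) k
        + 3 * t ^ 2 * ∑ k, g u k * g (Pi.single m 1) k ^ 2
        + t ^ 3 * ∑ k, g (Pi.single m 1) k ^ 3 = 0 := by
    rw [← hg (u + t • Pi.single m 1)]
    · simp only [map_add, map_smul, Pi.add_apply, Pi.smul_apply, smul_eq_mul, Finset.mul_sum,
        ← Finset.sum_add_distrib]
      exact Finset.sum_congr rfl fun k _ ↦ by ring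
    · have (k : Fin 4) : (u + t • Pi.single m 1 : Fin 4 → ℂ) k ^ 3
          = u k ^ 3 + (Pi.single m (t ^ 3) : Fin 4 → ℂ) k := by
        rcases eq_or_ne k m with rfl | hk
        · simp [hum]
        · simp [hk]
      simp only [this, Finset.sum_add_distrib]
      simp [ht, hs]
  have h₀ := expand s rfl
  have h₁ := expand (s * w) (by rw [mul_pow, hw3, mul_one])
  have h₂ := expand (s * w ^ 2) (by linear_combination s ^ 3 * (w ^ 3 + 1) * hw3)
  generalize ∑ k, g u k ^ 2 * g (Pi.single m 1) k = B at *
  generalize ∑ k, g u k * g (Pi.single m 1) k ^ 2 = C at *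
  generalize ∑ k, g u k ^ 3 = A at *
  generalize ∑ k, g (Pi.single m 1) k ^ 3 = D at *
  have : s * B * 9 = 0 := by grind
  simpa [hs0] using this

theorem apply_single_mul_apply_single (g : (Fin 4 → ℂ) ≃ₗ[ℂ] (Fin 4 → ℂ))
    (hg : ∀ v, ∑ k, v k ^ 3 = 0 → ∑ k, g v k ^ 3 = 0) {i j : Fin 4} (hij : i ≠ j) (k : Fin 4) :
    g (Pi.single i 1) k * g (Pi.single j 1) k = 0 := by
  have square {i m : Fin 4} (him : i ≠ m) :
      ∑ k, g (Pi.single i 1) k ^ 2 * g (Pi.single m 1) k = 0 := by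
    refine sum_sq_mul_eq_zero g hg m _ (by simp [him.symm]) ?_
    simp [Pi.single_apply, ite_pow]
  have triple (m : Fin 4) :
      ∑ k, g (Pi.single i 1) k * g (Pi.single j 1) k * g (Pi.single m 1) k = 0 := by
    rcases eq_or_ne i m with rfl | him
    · rw [← square hij]
      exact Finset.sum_congr rfl fun k _ ↦ by ring
    rcases eq_or_ne j m with rfl | hjm
    · rw [← square hij.symm]
      exact Finset.sum_congr rfl fun k _ ↦ by ring
    have hsum := sum_sq_mul_eq_zero g hg m (Pi.single i 1 + Pi.single j 1)
      (by simp [him.symm, hjm.symm]) (by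
        have (k : Fin 4) : (Pi.single i 1 + Pi.single j 1 : Fin 4 → ℂ) k ^ 3
            = (Pi.single i 1 : Fin 4 → ℂ) k + (Pi.single j 1 : Fin 4 → ℂ) k := by
          rcases eq_or_ne k i with rfl | hki
          · simp [hij]
          · rcases eq_or_ne k j with rfl | hkj <;> simp [*]
        simp only [this, Finset.sum_add_distrib]
        simp)
    have hi := square him
    have hj := square hjm
    have : 2 * ∑ k, g (Pi.single i 1) k * g (Pi.single j 1) k * g (Pi.single m 1) k
        = ∑ k, (g (Pi.single i 1 + Pi.single j 1) k) ^ 2 * g (Pi.single m 1) k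
          - ∑ k, g (Pi.single i 1) k ^ 2 * g (Pi.single m 1) k
          - ∑ k, g (Pi.single j 1) k ^ 2 * g (Pi.single m 1) k := by
      simp only [map_add, Pi.add_apply, Finset.mul_sum, ← Finset.sum_sub_distrib]
      exact Finset.sum_congr rfl fun k _ ↦ by ring
    simp only [LinearEquiv.coe_coe] at hsum
    rw [hsum, hi, hj] at this
    simpa using this
  let T : (Fin 4 → ℂ) →ₗ[ℂ] ℂ :=
    (∑ l, (g (Pi.single i 1) l * g (Pi.single j 1) l) • LinearMap.proj l) ∘ₗ
      (g : (Fin 4 → ℂ) →ₗ[ℂ] (Fin 4 → ℂ))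
  have hT : T = 0 := by
    refine (Pi.basisFun ℂ (Fin 4)).ext fun m ↦ ?_
    simpa [T, Pi.basisFun_apply] using triple m
  have := LinearMap.congr_fun hT (g.symm (Pi.single k 1))
  simpa [T, Pi.single_apply] using this

/-- A linear automorphism preserving the cone over the Fermat cubic is a monomial matrix. -/
theorem exists_perm_of_preserves_cone (g : (Fin 4 → ℂ) ≃ₗ[ℂ] (Fin 4 → ℂ))
    (hg : ∀ v, ∑ k, v k ^ 3 = 0 → ∑ k, g v k ^ 3 = 0) :
    ∃ (σ : Equiv.Perm (Fin 4)) (a : Fin 4 → ℂ), (∀ v k, g v k = a k * v (σ k)) ∧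
      (∀ k, a k ≠ 0) ∧ ∀ k, a k ^ 3 = a 0 ^ 3 := by
  have apply_eq (v : Fin 4 → ℂ) (k : Fin 4) : g v k = ∑ i, v i * g (Pi.single i 1) k := by
    conv_lhs => rw [pi_eq_sum_univ' v]
    simp [map_sum, Finset.sum_apply]
  have hne (k : Fin 4) : ∃ i, g (Pi.single i 1) k ≠ 0 := by
    by_contra! h
    have := apply_eq (g.symm (Pi.single k 1)) k
    simp [h] at this
  choose τ hτ using hne
  have formula (v : Fin 4 → ℂ) (k : Fin 4) :
      g v k = g (Pi.single (τ k) 1) k * v (τ k) := by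
    rw [apply_eq v k, Finset.sum_eq_single (τ k), mul_comm]
    · intro i _ hi
      have := apply_single_mul_apply_single g hg hi k
      rw [(mul_eq_zero.mp this).resolve_right (hτ k), mul_zero]
    · simp
  have hinj : Function.Injective τ := by
    intro k l hkl
    by_contra hne
    have hk := formula (g.symm (Pi.single k 1)) k
    have hl := formula (g.symm (Pi.single k 1)) l
    rw [← hkl] at hl
    simp only [LinearEquiv.apply_symm_apply, Pi.single_eq_same,
      Pi.single_eq_of_ne (Ne.symm hne)] at hk hl
    have h0 := (mul_eq_zero.mp hl.symm).resolve_left (hkl ▸ hτ l)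
    rw [h0, mul_zero] at hk
    exact one_ne_zero hk
  refine ⟨Equiv.ofBijective τ (Finite.injective_iff_bijective.mp hinj),
    fun k ↦ g (Pi.single (τ k) 1) k, formula, hτ, fun k ↦ ?_⟩
  rcases eq_or_ne k 0 with rfl | hk
  · rfl
  have hcone := hg (Pi.single (τ k) 1 - Pi.single (τ 0) 1) (by
    have hτk : τ k ≠ τ 0 := hinj.ne hk
    have (l : Fin 4) : (Pi.single (τ k) 1 - Pi.single (τ 0) 1 : Fin 4 → ℂ) l ^ 3
        = (Pi.single (τ k) 1 : Fin 4 → ℂ) l - (Pi.single (τ 0) 1 : Fin 4 → ℂ) l := by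
      rcases eq_or_ne l (τ k) with rfl | hlk
      · simp [hτk]
      · rcases eq_or_ne l (τ 0) with rfl | hl0
        · simp [hlk]; norm_num
        · simp [*]
    simp only [this, Finset.sum_sub_distrib]
    simp)
  have (l : Fin 4) : g (Pi.single (τ k) 1 - Pi.single (τ 0) 1) l ^ 3
      = (Pi.single k (g (Pi.single (τ k) 1) k ^ 3) : Fin 4 → ℂ) l
        - (Pi.single 0 (g (Pi.single (τ 0) 1) 0 ^ 3) : Fin 4 → ℂ) l := by
    rw [formula]
    rcases eq_or_ne l k with rfl | hlk
    · simp [hk, hinj.ne hk]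
    · rcases eq_or_ne l 0 with rfl | hl0
      · simp [hlk, hinj.ne hlk]; ring
      · simp [hlk, hl0, hinj.ne hlk, hinj.ne hl0]
  simp only [this, Finset.sum_sub_distrib] at hcone
  simpa [sub_eq_zero] using hcone

/-- The monomial automorphism `v ↦ (c k * v (σ k))ₖ`. -/
def monomialEquiv (σ : Equiv.Perm (Fin 4)) (c : Fin 4 → ℂˣ) : (Fin 4 → ℂ) ≃ₗ[ℂ] (Fin 4 → ℂ) :=
  (LinearEquiv.funCongrLeft ℂ ℂ σ).trans
    (LinearEquiv.piCongrRight fun k ↦ LinearEquiv.smulOfUnit (c k))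

@[simp]
theorem monomialEquiv_apply (σ : Equiv.Perm (Fin 4)) (c : Fin 4 → ℂˣ) (v : Fin 4 → ℂ)
    (k : Fin 4) : monomialEquiv σ c v k = c k * v (σ k) :=
  rfl

/-- The projective transformation attached to a permutation and three cube roots of unity. -/
def monomialSymmetry (p : Equiv.Perm (Fin 4) × (Fin 3 → rootsOfUnity 3 ℂ)) :
    Projectivization ℂ (Fin 4 → ℂ) → Projectivization ℂ (Fin 4 → ℂ) :=
  let g := monomialEquiv p.1 (Fin.cons 1 fun i ↦ (p.2 i : ℂˣ))
  Projectivization.map (g : (Fin 4 → ℂ) →ₗ[ℂ] (Fin 4 → ℂ)) g.injective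

theorem monomialSymmetry_injective : Function.Injective monomialSymmetry := by
  rintro ⟨σ, c⟩ ⟨τ, d⟩ h
  have proportional (v : Fin 4 → ℂ) (hv : v ≠ 0) : ∃ a : ℂˣ, ∀ k,
      a * (((Fin.cons 1 fun i ↦ (d i : ℂˣ)) : Fin 4 → ℂˣ) k * v (τ k))
        = ((Fin.cons 1 fun i ↦ (c i : ℂˣ)) : Fin 4 → ℂˣ) k * v (σ k) := by
    have := congr_fun h (Projectivization.mk ℂ v hv)
    simp only [monomialSymmetry, Projectivization.map_mk, Projectivization.mk_eq_mk_iff] at this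
    obtain ⟨a, ha⟩ := this
    exact ⟨a, fun k ↦ congr_fun ha k⟩
  have hcd : c = d := by
    obtain ⟨a, ha⟩ := proportional 1 one_ne_zero
    have ha1 : (a : ℂ) = 1 := by simpa using ha 0
    ext i
    simpa [ha1] using (ha i.succ).symm
  subst hcd
  have hv : (fun i : Fin 4 ↦ (i : ℂ) + 1) ≠ 0 := fun h ↦ by simpa using congr_fun h 0
  obtain ⟨a, ha⟩ := proportional _ hv
  have ha' (k : Fin 4) : (a : ℂ) * ((τ k : ℂ) + 1) = (σ k : ℂ) + 1 := by
    refine mul_left_cancel₀ (Units.ne_zero _) ((mul_left_comm _ _ _).trans (ha k))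
  have hsum : (a : ℂ) * ∑ k, ((τ k : ℂ) + 1) = ∑ k, ((σ k : ℂ) + 1) := by
    rw [Finset.mul_sum]
    exact Finset.sum_congr rfl fun k _ ↦ ha' k
  rw [Equiv.sum_comp τ (fun i : Fin 4 ↦ (i : ℂ) + 1),
    Equiv.sum_comp σ (fun i : Fin 4 ↦ (i : ℂ) + 1)] at hsum
  have ha1 : (a : ℂ) = 1 := by
    simp only [Fin.sum_univ_four] at hsum
    norm_num at hsum
    simpa using hsum
  congr 1
  ext k
  have := ha' k
  rw [ha1, one_mul, add_left_inj] at this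
  exact_mod_cast this.symm

theorem monomialSymmetry_image_fermatLocus (p : Equiv.Perm (Fin 4) × (Fin 3 → rootsOfUnity 3 ℂ)) :
    monomialSymmetry p '' fermatLocus = fermatLocus := by
  have hroot (k : Fin 4) :
      (((Fin.cons 1 fun i ↦ (p.2 i : ℂˣ)) : Fin 4 → ℂˣ) k : ℂ) ^ 3 = 1 := by
    refine Fin.cases (by simp) (fun i ↦ ?_) k
    simpa using (mem_rootsOfUnity' 3 _).mp (p.2 i).2
  set c : Fin 4 → ℂˣ := Fin.cons 1 fun i ↦ (p.2 i : ℂˣ) with hc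
  have invariant (v : Fin 4 → ℂ) : ∑ k, monomialEquiv p.1 c v k ^ 3 = ∑ k, v k ^ 3 := by
    simp only [monomialEquiv_apply, mul_pow, hroot, one_mul]
    exact Equiv.sum_comp p.1 fun k ↦ v k ^ 3
  apply Set.Subset.antisymm
  · rintro _ ⟨q, hq, rfl⟩
    induction q using Projectivization.ind with
    | h v hv =>
      rw [mk_mem_fermatLocus_iff] at hq
      simp only [monomialSymmetry, Projectivization.map_mk, mk_mem_fermatLocus_iff]
      exact (invariant v).trans hq
  · intro q hq
    induction q using Projectivization.ind with
    | h v hv =>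
      rw [mk_mem_fermatLocus_iff] at hq
      have hv' : (monomialEquiv p.1 c).symm v ≠ 0 := by simpa using hv
      refine ⟨Projectivization.mk ℂ _ hv', ?_, ?_⟩
      · rw [mk_mem_fermatLocus_iff, ← invariant]
        simpa only [LinearEquiv.apply_symm_apply] using hq
      · simp only [monomialSymmetry, Projectivization.map_mk, ← hc]
        congr 1
        exact (monomialEquiv p.1 c).apply_symm_apply v

theorem exists_monomialSymmetry_eq (g : (Fin 4 → ℂ) ≃ₗ[ℂ] (Fin 4 → ℂ))
    (hg : ∀ v, ∑ k, v k ^ 3 = 0 → ∑ k, g v k ^ 3 = 0) :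
    ∃ p, monomialSymmetry p
      = Projectivization.map (g : (Fin 4 → ℂ) →ₗ[ℂ] (Fin 4 → ℂ)) g.injective := by
  obtain ⟨σ, a, hga, ha0, ha⟩ := exists_perm_of_preserves_cone g hg
  let c (i : Fin 3) : rootsOfUnity 3 ℂ :=
    ⟨Units.mk0 (a i.succ / a 0) (div_ne_zero (ha0 _) (ha0 0)), by
      rw [mem_rootsOfUnity']
      simp [div_pow, ha i.succ, ha0 0]⟩
  refine ⟨(σ, c), funext fun q ↦ ?_⟩
  induction q using Projectivization.ind with
  | h v hv =>
    simp only [monomialSymmetry, Projectivization.map_mk, Projectivization.mk_eq_mk_iff']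
    refine ⟨(a 0)⁻¹, funext fun k ↦ ?_⟩
    simp only [Pi.smul_apply, LinearEquiv.coe_coe, hga, monomialEquiv_apply, smul_eq_mul]
    refine Fin.cases ?_ (fun i ↦ ?_) k
    · simp [ha0 0]
    · simp only [Fin.cons_succ, c, Units.val_mk0]
      ring

/-- The group of projective symmetries of the Fermat cubic surface has exactly 648
elements: the set of projective transformations of `ℙ³(ℂ)` (maps induced by `ℂ`-linear
automorphisms of `ℂ⁴`) mapping the Fermat cubic surface onto itself has cardinality 648. -/
theorem fermat_symmetry_group_card :
    {φ : Projectivization ℂ (Fin 4 → ℂ) → Projectivization ℂ (Fin 4 → ℂ) |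
        (∃ g : (Fin 4 → ℂ) ≃ₗ[ℂ] (Fin 4 → ℂ),
          φ = Projectivization.map (g : (Fin 4 → ℂ) →ₗ[ℂ] (Fin 4 → ℂ)) g.injective) ∧
        φ '' fermatLocus = fermatLocus}.encard = 648 := by
  have range_eq : {φ : Projectivization ℂ (Fin 4 → ℂ) → Projectivization ℂ (Fin 4 → ℂ) |
        (∃ g : (Fin 4 → ℂ) ≃ₗ[ℂ] (Fin 4 → ℂ),
          φ = Projectivization.map (g : (Fin 4 → ℂ) →ₗ[ℂ] (Fin 4 → ℂ)) g.injective) ∧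
        φ '' fermatLocus = fermatLocus} = Set.range monomialSymmetry := by
    ext φ
    constructor
    · rintro ⟨⟨g, rfl⟩, himage⟩
      refine exists_monomialSymmetry_eq g fun v hv ↦ ?_
      rcases eq_or_ne v 0 with rfl | hv0
      · simp
      have hmem := Set.mem_image_of_mem
        (Projectivization.map (g : (Fin 4 → ℂ) →ₗ[ℂ] (Fin 4 → ℂ)) g.injective)
        ((mk_mem_fermatLocus_iff v hv0).mpr hv)
      rw [himage, Projectivization.map_mk, mk_mem_fermatLocus_iff] at hmem
      exact hmem
    · rintro ⟨p, rfl⟩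
      exact ⟨⟨_, rfl⟩, monomialSymmetry_image_fermatLocus p⟩
  rw [range_eq, ← Set.image_univ, monomialSymmetry_injective.encard_image, Set.encard_univ,
    ENat.card_eq_coe_natCard, Nat.card_prod, Nat.card_perm, Nat.card_fun,
    Complex.card_rootsOfUnity, Nat.card_fin, Nat.card_fin]
  norm_num [Nat.factorial]
end
end
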